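/- For ρ¹ = (σ¹,τ¹), ρ² = (σ²,τ²) ∈ Σ_N², let f₂(ρ¹,ρ²) = σ_N¹·τ_N¹·R⁻(σ¹,τ¹)·R(σ²,τ²)². There is a universal constant K > 0 such that for all N ≥ 1, all β ∈ (0,1], and all t, s ∈ [0,1], both |∂²/∂s² E⟨f₂⟩_{t,s}| ≤ K·(E⟨R(σ,τ)²⟩_t)^{3/4}·(E⟨R(σ¹,σ²)^{16}⟩)^{7/32} and |∂²/∂s² E⟨f₂⟩_{t,s}| ≤ K·(E⟨R(σ¹,τ¹)²·R(σ²,τ²)²⟩_t)^{1/2}·(E⟨R(σ,τ)²⟩_t)^{1/6}·(E⟨R(σ¹,σ²)⁸⟩)^{1/3}, where ⟨·⟩ is the Gibbs average of the original single SK system at inverse temperature β. -/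

import Mathlib

open MeasureTheory ProbabilityTheory Real Finset Filter

noncomputable section

/-- Spin configurations: each of the `N` sites carries a `±1` spin, encoded by a `Bool`. -/
abbrev Config (N : ℕ) := Fin N → Bool

/-- The `±1` value of a spin. -/
def spin (b : Bool) : ℝ := if b then 1 else -1

/-- The value of the last spin `σ_N` (junk value `0` when `N = 0`). -/
def spinLast {N : ℕ} (σ : Config N) : ℝ :=
  if h : 0 < N then spin (σ ⟨N - 1, Nat.sub_lt h Nat.one_pos⟩) else 0

/-- The Gaussian disorder: i.i.d. standard Gaussians indexed by pairs `(i, j)`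
(only the entries with `i < j` are used). -/
def gaussPi (N : ℕ) : Measure (Fin N × Fin N → ℝ) :=
  Measure.pi fun _ => gaussianReal 0 1

instance (N : ℕ) : IsProbabilityMeasure (gaussPi N) := by
  unfold gaussPi; infer_instance

/-- Three independent copies `g, g', g''` of the disorder. -/
def disM3 (N : ℕ) :
    Measure ((Fin N × Fin N → ℝ) × (Fin N × Fin N → ℝ) × (Fin N × Fin N → ℝ)) :=
  (gaussPi N).prod ((gaussPi N).prod (gaussPi N))

/-- The SK Hamiltonian `H_{N,β}(σ) = (β/√N) ∑_{i<j} g_{ij} σ_i σ_j`. -/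
def ham (N : ℕ) (β : ℝ) (g : Fin N × Fin N → ℝ) (σ : Config N) : ℝ :=
  (β / Real.sqrt N) *
    ∑ p ∈ Finset.univ.filter (fun p : Fin N × Fin N => p.1 < p.2),
      g p * spin (σ p.1) * spin (σ p.2)

/-- The cavity Hamiltonian `H⁻_N(σ) = (β/√N) ∑_{i<j<N} g_{ij} σ_i σ_j` on the first
`N - 1` spins. -/
def hamCav (N : ℕ) (β : ℝ) (g : Fin N × Fin N → ℝ) (σ : Config N) : ℝ :=
  (β / Real.sqrt N) *
    ∑ p ∈ Finset.univ.filter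
        (fun p : Fin N × Fin N => p.1 < p.2 ∧ (p.2 : ℕ) < N - 1),
      g p * spin (σ p.1) * spin (σ p.2)

/-- The overlap `R(σ¹,σ²) = (1/N) ∑_{i ≤ N} σ_i¹ σ_i²`. -/
def ovlp (N : ℕ) (σ τ : Config N) : ℝ := (∑ i, spin (σ i) * spin (τ i)) / N

/-- The truncated overlap `R⁻(σ¹,σ²) = (1/N) ∑_{i ≤ N−1} σ_i¹ σ_i²`. -/
def ovlpm (N : ℕ) (σ τ : Config N) : ℝ :=
  (∑ i ∈ Finset.univ.filter (fun i : Fin N => (i : ℕ) < N - 1),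
    spin (σ i) * spin (τ i)) / N

/-- The partition function `Z_N(β)`. -/
def partFun (N : ℕ) (β : ℝ) (g : Fin N × Fin N → ℝ) : ℝ :=
  ∑ σ : Config N, Real.exp (ham N β g σ)

/-- The free energy `F_N(β) = ln Z_N(β)`. -/
def freeEnergy (N : ℕ) (β : ℝ) (g : Fin N × Fin N → ℝ) : ℝ :=
  Real.log (partFun N β g)

/-- Two-replica Gibbs average `⟨f⟩` for the single SK system. -/
def gibbs2 (N : ℕ) (β : ℝ) (g : Fin N × Fin N → ℝ)
    (f : Config N → Config N → ℝ) : ℝ :=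
  (∑ σ : Config N, ∑ τ : Config N,
    f σ τ * Real.exp (ham N β g σ + ham N β g τ)) / (partFun N β g) ^ 2

/-- Disorder expectation of the two-replica Gibbs average. -/
def Egibbs2 (N : ℕ) (β : ℝ) (f : Config N → Config N → ℝ) : ℝ :=
  ∫ g, gibbs2 N β g f ∂gaussPi N

/-- The interpolated Hamiltonian `√t · H_N + √(1−t) · H'_N`. -/
def hamT (N : ℕ) (β t : ℝ) (g g' : Fin N × Fin N → ℝ) (σ : Config N) : ℝ :=
  Real.sqrt t * ham N β g σ + Real.sqrt (1 - t) * ham N β g' σ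

/-- The coupled Gibbs weight `exp(H¹_{N,t}(σ) + H²_{N,t}(τ))`. -/
def wT (N : ℕ) (β t : ℝ) (g g' g'' : Fin N × Fin N → ℝ)
    (ρ : Config N × Config N) : ℝ :=
  Real.exp (hamT N β t g g' ρ.1 + hamT N β t g g'' ρ.2)

/-- The coupled Gibbs average `⟨f⟩_t` of a function of one pair `(σ, τ)`. -/
def gibbsT (N : ℕ) (β t : ℝ) (g g' g'' : Fin N × Fin N → ℝ)
    (f : Config N × Config N → ℝ) : ℝ :=
  (∑ ρ : Config N × Config N, f ρ * wT N β t g g' g'' ρ) /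
    (∑ ρ : Config N × Config N, wT N β t g g' g'' ρ)

/-- The coupled Gibbs average `⟨f⟩_t` of a function of two pairs. -/
def gibbsT2 (N : ℕ) (β t : ℝ) (g g' g'' : Fin N × Fin N → ℝ)
    (f : Config N × Config N → Config N × Config N → ℝ) : ℝ :=
  (∑ ρ₁ : Config N × Config N, ∑ ρ₂ : Config N × Config N,
    f ρ₁ ρ₂ * wT N β t g g' g'' ρ₁ * wT N β t g g' g'' ρ₂) /
    (∑ ρ : Config N × Config N, wT N β t g g' g'' ρ) ^ 2

/-- Disorder expectation `E⟨f⟩_t` (one pair). -/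
def EgibbsT (N : ℕ) (β t : ℝ) (f : Config N × Config N → ℝ) : ℝ :=
  ∫ ω, gibbsT N β t ω.1 ω.2.1 ω.2.2 f ∂disM3 N

/-- Disorder expectation `E⟨f⟩_t` (two pairs). -/
def EgibbsT2 (N : ℕ) (β t : ℝ)
    (f : Config N × Config N → Config N × Config N → ℝ) : ℝ :=
  ∫ ω, gibbsT2 N β t ω.1 ω.2.1 ω.2.2 f ∂disM3 N

/-- The `s`-dependent cavity field term
`(β/√N) σ_N ∑_{i<N} (√t g_{iN} + √(1−t) g'_{iN}) σ_i`. -/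
def cavField (N : ℕ) (β t : ℝ) (g g' : Fin N × Fin N → ℝ) (σ : Config N) : ℝ :=
  if h : 0 < N then
    (β / Real.sqrt N) * spin (σ ⟨N - 1, Nat.sub_lt h Nat.one_pos⟩) *
      ∑ i ∈ Finset.univ.filter (fun i : Fin N => (i : ℕ) < N - 1),
        (Real.sqrt t * g (i, ⟨N - 1, Nat.sub_lt h Nat.one_pos⟩) +
          Real.sqrt (1 - t) * g' (i, ⟨N - 1, Nat.sub_lt h Nat.one_pos⟩)) * spin (σ i)
  else 0

/-- The cavity-interpolated Hamiltonian `H^1_{N,t,s}` (resp. `H^2_{N,t,s}` with `g''`). -/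
def hamTS (N : ℕ) (β t s : ℝ) (g g' : Fin N × Fin N → ℝ) (σ : Config N) : ℝ :=
  Real.sqrt t * hamCav N β g σ + Real.sqrt (1 - t) * hamCav N β g' σ +
    Real.sqrt s * cavField N β t g g' σ

/-- The coupled cavity Gibbs weight `exp(H¹_{N,t,s}(σ) + H²_{N,t,s}(τ))`. -/
def wTS (N : ℕ) (β t s : ℝ) (g g' g'' : Fin N × Fin N → ℝ)
    (ρ : Config N × Config N) : ℝ :=
  Real.exp (hamTS N β t s g g' ρ.1 + hamTS N β t s g g'' ρ.2)

/-- The coupled cavity Gibbs average `⟨f⟩_{t,s}` of a function of one pair. -/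
def gibbsTS1 (N : ℕ) (β t s : ℝ) (g g' g'' : Fin N × Fin N → ℝ)
    (f : Config N × Config N → ℝ) : ℝ :=
  (∑ ρ : Config N × Config N, f ρ * wTS N β t s g g' g'' ρ) /
    (∑ ρ : Config N × Config N, wTS N β t s g g' g'' ρ)

/-- The coupled cavity Gibbs average `⟨f⟩_{t,s}` of a function of two pairs. -/
def gibbsTS2 (N : ℕ) (β t s : ℝ) (g g' g'' : Fin N × Fin N → ℝ)
    (f : Config N × Config N → Config N × Config N → ℝ) : ℝ :=
  (∑ ρ₁ : Config N × Config N, ∑ ρ₂ : Config N × Config N,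
    f ρ₁ ρ₂ * wTS N β t s g g' g'' ρ₁ * wTS N β t s g g' g'' ρ₂) /
    (∑ ρ : Config N × Config N, wTS N β t s g g' g'' ρ) ^ 2

/-- The coupled cavity Gibbs average `⟨f⟩_{t,s}` of a function of `n` pairs. -/
def gibbsTSn (N : ℕ) (β t s : ℝ) (g g' g'' : Fin N × Fin N → ℝ) {n : ℕ}
    (f : (Fin n → Config N × Config N) → ℝ) : ℝ :=
  (∑ ρ : Fin n → Config N × Config N, f ρ * ∏ l, wTS N β t s g g' g'' (ρ l)) /
    (∑ ρ₀ : Config N × Config N, wTS N β t s g g' g'' ρ₀) ^ n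

/-- Disorder expectation `E⟨f⟩_{t,s}` (one pair). -/
def EgibbsTS1 (N : ℕ) (β t s : ℝ) (f : Config N × Config N → ℝ) : ℝ :=
  ∫ ω, gibbsTS1 N β t s ω.1 ω.2.1 ω.2.2 f ∂disM3 N

/-- Disorder expectation `E⟨f⟩_{t,s}` (two pairs). -/
def EgibbsTS2 (N : ℕ) (β t s : ℝ)
    (f : Config N × Config N → Config N × Config N → ℝ) : ℝ :=
  ∫ ω, gibbsTS2 N β t s ω.1 ω.2.1 ω.2.2 f ∂disM3 N

/-- Disorder expectation `E⟨f⟩_{t,s}` (`n` pairs). -/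
def EgibbsTSn (N : ℕ) (β t s : ℝ) {n : ℕ}
    (f : (Fin n → Config N × Config N) → ℝ) : ℝ :=
  ∫ ω, gibbsTSn N β t s ω.1 ω.2.1 ω.2.2 f ∂disM3 N

/-- The covariance kernel `U(ρ, ρ')` of the `s`-part of the coupled cavity Hamiltonians. -/
def Ufun (N : ℕ) (β t : ℝ) (ρ ρ' : Config N × Config N) : ℝ :=
  β ^ 2 / 2 * (spinLast ρ.1 * spinLast ρ'.1 * ovlpm N ρ.1 ρ'.1 +
      spinLast ρ.2 * spinLast ρ'.2 * ovlpm N ρ.2 ρ'.2) +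
    β ^ 2 * t / 2 * (spinLast ρ.1 * spinLast ρ'.2 * ovlpm N ρ.1 ρ'.2 +
      spinLast ρ.2 * spinLast ρ'.1 * ovlpm N ρ.2 ρ'.1)

/-- `ν(β) = −(1/2)·ln(1 − β²) − β²/2`. -/
def nuSK (b : ℝ) : ℝ := -(1 / 2) * Real.log (1 - b ^ 2) - b ^ 2 / 2

/-- The Gibbs probability of the state `ρ` for the energy function `E` on a finite set. -/
def gibbsProb {S : Type*} [Fintype S] (E : S → ℝ) (ρ : S) : ℝ :=
  Real.exp (E ρ) / ∑ ρ', Real.exp (E ρ')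

/-- The Gibbs average of a function of `n` independent replicas. -/
def replicaAvg {S : Type*} [Fintype S] {n : ℕ} (E : S → ℝ) (f : (Fin n → S) → ℝ) : ℝ :=
  ∑ ρ, f ρ * ∏ l, gibbsProb E (ρ l)

/-- The function of `n + 1` replicas whose average is the derivative of the average of `f`
when the energy varies in the direction `u`. The new replica has index `0`. -/
def replicaDiff {S : Type*} {n : ℕ} (u : S → ℝ) (f : (Fin n → S) → ℝ)
    (ρ : Fin (n + 1) → S) : ℝ :=
  f (Fin.tail ρ) * (∑ l : Fin n, u (ρ l.succ) - n * u (ρ 0))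

section Gibbs

variable {S : Type*} [Fintype S]

lemma gibbsProb_nonneg (E : S → ℝ) (ρ : S) : 0 ≤ gibbsProb E ρ :=
  div_nonneg (Real.exp_nonneg _) (Finset.sum_nonneg fun _ _ => Real.exp_nonneg _)

lemma gibbsProb_le_one (E : S → ℝ) (ρ : S) : gibbsProb E ρ ≤ 1 :=
  div_le_one_of_le₀
    (Finset.single_le_sum (f := fun ρ' => Real.exp (E ρ')) (fun _ _ => Real.exp_nonneg _)
      (Finset.mem_univ ρ))
    (Finset.sum_nonneg fun _ _ => Real.exp_nonneg _)

lemma sum_exp_pos [Nonempty S] (E : S → ℝ) : 0 < ∑ ρ, Real.exp (E ρ) :=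
  Finset.sum_pos (fun _ _ => Real.exp_pos _) Finset.univ_nonempty

lemma sum_gibbsProb [Nonempty S] (E : S → ℝ) : ∑ ρ, gibbsProb E ρ = 1 := by
  simp only [gibbsProb]
  rw [← Finset.sum_div, div_self (sum_exp_pos E).ne']

lemma sum_mul_gibbsProb (E : S → ℝ) (u : S → ℝ) :
    ∑ ρ, u ρ * gibbsProb E ρ = (∑ ρ, u ρ * Real.exp (E ρ)) / ∑ ρ, Real.exp (E ρ) := by
  simp only [gibbsProb, mul_div_assoc', Finset.sum_div]

lemma continuous_gibbsProb [Nonempty S] (ρ : S) :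
    Continuous fun E : S → ℝ => gibbsProb E ρ := by
  unfold gibbsProb
  exact Continuous.div (by fun_prop) (by fun_prop) fun E => (sum_exp_pos E).ne'

lemma continuous_replicaAvg [Nonempty S] {n : ℕ} (f : (Fin n → S) → ℝ) :
    Continuous fun E : S → ℝ => replicaAvg E f := by
  unfold replicaAvg
  exact continuous_finsetSum _ fun ρ _ => continuous_const.mul
    (continuous_finsetProd _ fun l _ => continuous_gibbsProb (ρ l))

lemma abs_replicaAvg_le {n : ℕ} (E : S → ℝ) (f : (Fin n → S) → ℝ) :
    |replicaAvg E f| ≤ ∑ ρ, |f ρ| := by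
  refine (Finset.abs_sum_le_sum_abs _ _).trans (Finset.sum_le_sum fun ρ _ => ?_)
  rw [abs_mul, abs_of_nonneg (Finset.prod_nonneg fun l _ => gibbsProb_nonneg E (ρ l))]
  exact mul_le_of_le_one_right (abs_nonneg _)
    (Finset.prod_le_one (fun l _ => gibbsProb_nonneg E _) fun l _ => gibbsProb_le_one E _)

lemma replicaAvg_prod {n : ℕ} (E : S → ℝ) (u : Fin n → S → ℝ) :
    replicaAvg E (fun ρ => ∏ l, u l (ρ l)) = ∏ l, ∑ ρ, u l ρ * gibbsProb E ρ := by
  rw [Finset.prod_univ_sum, Fintype.piFinset_univ]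
  simp only [replicaAvg, Finset.prod_mul_distrib]

lemma replicaAvg_apply [Nonempty S] {n : ℕ} (E : S → ℝ) (u : S → ℝ) (l : Fin n) :
    replicaAvg E (fun ρ => u (ρ l)) = ∑ ρ, u ρ * gibbsProb E ρ := by
  have h := replicaAvg_prod E (fun i : Fin n => if i = l then u else fun _ => 1)
  rw [Finset.prod_eq_single l] at h
  · simp only [if_true] at h
    rw [← h]
    congr 1
    ext ρ
    rw [Finset.prod_eq_single l] <;> simp +contextual
  · intro b _ hb
    simp [hb, sum_gibbsProb]
  · simp

lemma replicaAvg_apply_mul_apply [Nonempty S] {n : ℕ} (E : S → ℝ) (u v : S → ℝ) {l m : Fin n}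
    (hlm : l ≠ m) :
    replicaAvg E (fun ρ => u (ρ l) * v (ρ m)) =
      (∑ ρ, u ρ * gibbsProb E ρ) * ∑ ρ, v ρ * gibbsProb E ρ := by
  have h := replicaAvg_prod E
    (fun i : Fin n => if i = l then u else if i = m then v else fun _ => 1)
  rw [Fintype.prod_eq_mul l m hlm] at h
  · simp only [if_true, hlm.symm, if_false] at h
    rw [← h]
    congr 1
    ext ρ
    rw [Fintype.prod_eq_mul l m hlm]
    · simp [hlm.symm]
    · rintro x ⟨h1, h2⟩
      simp [h1, h2]
  · rintro x ⟨h1, h2⟩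
    simp [h1, h2, sum_gibbsProb]

lemma replicaAvg_succ {n : ℕ} (E : S → ℝ) (F : S → (Fin n → S) → ℝ) :
    replicaAvg E (fun ρ : Fin (n + 1) → S => F (ρ 0) (Fin.tail ρ)) =
      ∑ a, gibbsProb E a * replicaAvg E (F a) := by
  simp only [replicaAvg]
  rw [← (Fin.consEquiv fun _ => S).sum_comp, Fintype.sum_prod_type]
  refine Finset.sum_congr rfl fun a _ => ?_
  rw [Finset.mul_sum]
  refine Finset.sum_congr rfl fun ρ _ => ?_
  have htail : Fin.tail ((Fin.consEquiv fun _ => S) (a, ρ)) = ρ := by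
    ext i; simp [Fin.tail]
  rw [htail]
  simp only [Fin.consEquiv_apply, Fin.cons_zero, Fin.prod_univ_succ, Fin.cons_succ]
  ring

lemma replicaAvg_tail [Nonempty S] {n : ℕ} (E : S → ℝ) (f : (Fin n → S) → ℝ) :
    replicaAvg E (fun ρ : Fin (n + 1) → S => f (Fin.tail ρ)) = replicaAvg E f := by
  rw [replicaAvg_succ E fun _ => f, ← Finset.sum_mul, sum_gibbsProb, one_mul]

lemma hasDerivAt_gibbsProb [Nonempty S] {E : ℝ → S → ℝ} {u : S → ℝ} {θ : ℝ}
    (hE : ∀ ρ, HasDerivAt (fun x => E x ρ) (u ρ) θ) (ρ : S) :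
    HasDerivAt (fun x => gibbsProb (E x) ρ)
      (gibbsProb (E θ) ρ * (u ρ - ∑ a, u a * gibbsProb (E θ) a)) θ := by
  have hZ := (sum_exp_pos (E θ)).ne'
  have h := (hE ρ).exp.div (HasDerivAt.fun_sum (u := Finset.univ) fun a _ => (hE a).exp) hZ
  refine h.congr_deriv ?_
  rw [sum_mul_gibbsProb]
  simp only [gibbsProb, mul_comm (u _)]
  field_simp

/-- Derivative of a replica average with respect to a parameter of the energy. -/
lemma hasDerivAt_replicaAvg [Nonempty S] {n : ℕ} {E : ℝ → S → ℝ} {u : S → ℝ} {θ : ℝ}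
    (hE : ∀ ρ, HasDerivAt (fun x => E x ρ) (u ρ) θ) (f : (Fin n → S) → ℝ) :
    HasDerivAt (fun x => replicaAvg (E x) f) (replicaAvg (E θ) (replicaDiff u f)) θ := by
  have h := HasDerivAt.fun_sum (u := Finset.univ) fun (ρ : Fin n → S) _ =>
    (HasDerivAt.fun_finsetProd (u := Finset.univ) fun l _ =>
      hasDerivAt_gibbsProb hE (ρ l)).const_mul (f ρ)
  refine h.congr_deriv ?_
  have hsum : ∀ ρ : Fin n → S, ∑ l, (∏ j ∈ Finset.univ.erase l, gibbsProb (E θ) (ρ j)) •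
      (gibbsProb (E θ) (ρ l) * (u (ρ l) - ∑ a, u a * gibbsProb (E θ) a)) =
      (∑ l, u (ρ l) - n * ∑ a, u a * gibbsProb (E θ) a) * ∏ l, gibbsProb (E θ) (ρ l) := by
    intro ρ
    have : ∀ l, (∏ j ∈ Finset.univ.erase l, gibbsProb (E θ) (ρ j)) •
        (gibbsProb (E θ) (ρ l) * (u (ρ l) - ∑ a, u a * gibbsProb (E θ) a)) =
        (u (ρ l) - ∑ a, u a * gibbsProb (E θ) a) * ∏ l, gibbsProb (E θ) (ρ l) := by
      intro l
      rw [← Finset.prod_erase_mul Finset.univ _ (Finset.mem_univ l), smul_eq_mul]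
      ring
    simp only [this]
    rw [← Finset.sum_mul, Finset.sum_sub_distrib]
    simp
  simp only [hsum]
  have hdiff := replicaAvg_succ (E θ) fun a (ρ : Fin n → S) =>
    f ρ * (∑ l, u (ρ l) - n * u a)
  refine Eq.trans ?_ hdiff.symm
  simp only [replicaAvg]
  conv_rhs => enter [2, a]; rw [Finset.mul_sum]
  rw [Finset.sum_comm]
  refine Finset.sum_congr rfl fun ρ _ => ?_
  have hone := sum_gibbsProb (E θ)
  calc _ = f ρ * ((∑ l, u (ρ l)) * (∑ a, gibbsProb (E θ) a) -
        n * ∑ a, u a * gibbsProb (E θ) a) * ∏ l, gibbsProb (E θ) (ρ l) := by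
        rw [hone, mul_one, mul_assoc]
    _ = _ := by
        rw [Finset.mul_sum, Finset.mul_sum, ← Finset.sum_sub_distrib, Finset.mul_sum,
          Finset.sum_mul]
        refine Finset.sum_congr rfl fun a _ => ?_
        ring

end Gibbs

/-- Gaussian integration by parts in dimension one. -/
lemma integral_id_mul_gaussianReal {φ φ' : ℝ → ℝ} {C C' : ℝ}
    (hd : ∀ x, HasDerivAt φ (φ' x) x) (hm : Measurable φ')
    (hC : ∀ x, |φ x| ≤ C) (hC' : ∀ x, |φ' x| ≤ C') :
    ∫ x, x * φ x ∂gaussianReal 0 1 = ∫ x, φ' x ∂gaussianReal 0 1 := by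
  have hcont : Continuous φ := continuous_iff_continuousAt.2 fun x => (hd x).continuousAt
  have h_int : ∀ f : ℝ → ℝ, Integrable f (gaussianReal 0 1) →
      Integrable fun x => f x * gaussianPDFReal 0 1 x := by
    intro f hf
    rw [gaussianReal_of_var_ne_zero 0 one_ne_zero,
      integrable_withDensity_iff_integrable_smul' (measurable_gaussianPDF 0 1)
        (ae_of_all _ fun x => gaussianPDF_lt_top)] at hf
    refine hf.congr (ae_of_all _ fun x => ?_)
    simp only [toReal_gaussianPDF, smul_eq_mul]
    ring
  have hid : Integrable (fun x : ℝ => x) (gaussianReal 0 1) :=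
    memLp_one_iff_integrable.1 (memLp_id_gaussianReal' 1 ENNReal.one_ne_top)
  have hpdf : ∀ x, HasDerivAt (gaussianPDFReal 0 1) (-(x * gaussianPDFReal 0 1 x)) x := by
    intro x
    have h := ((((hasDerivAt_id x).pow 2).neg.div_const 2).exp).const_mul (√(2 * π))⁻¹
    refine (h.congr_of_eventuallyEq (Eventually.of_forall fun y => ?_)).congr_deriv ?_
    · simp [gaussianPDFReal]
    · simp [gaussianPDFReal]; ring
  have hφ' : Integrable φ' (gaussianReal 0 1) :=
    Integrable.of_bound hm.aestronglyMeasurable C' (ae_of_all _ fun x => by simpa using hC' x)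
  have hφ : Integrable φ (gaussianReal 0 1) :=
    Integrable.of_bound hcont.aestronglyMeasurable C (ae_of_all _ fun x => by simpa using hC x)
  have hxφ : Integrable (fun x => x * φ x) (gaussianReal 0 1) :=
    hid.mul_bdd hcont.aestronglyMeasurable (ae_of_all _ fun x => by simpa using hC x)
  have h := integral_mul_deriv_eq_deriv_mul_of_integrable (fun x _ => hd x) (fun x _ => hpdf x)
    ((h_int _ hxφ).neg.congr (ae_of_all _ fun x => by simp; ring)) (h_int _ hφ') (h_int _ hφ)
  rw [integral_gaussianReal_eq_integral_smul one_ne_zero,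
    integral_gaussianReal_eq_integral_smul one_ne_zero]
  simp only [smul_eq_mul]
  have h1 : ∀ x, gaussianPDFReal 0 1 x * (x * φ x) = -(φ x * -(x * gaussianPDFReal 0 1 x)) :=
    fun x => by ring
  simp only [h1, integral_neg, h, neg_neg]
  simp only [mul_comm]

/-- The standard Gaussian measure on `κ → ℝ`. -/
def stdGaussPi (κ : Type*) [Fintype κ] : Measure (κ → ℝ) :=
  Measure.pi fun _ => gaussianReal 0 1

instance (κ : Type*) [Fintype κ] : IsProbabilityMeasure (stdGaussPi κ) := by
  unfold stdGaussPi; infer_instance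

lemma integrable_eval_stdGaussPi {κ : Type*} [Fintype κ] (k : κ) :
    Integrable (fun x : κ → ℝ => x k) (stdGaussPi κ) := by
  have hid : Integrable (fun x : ℝ => x) (gaussianReal 0 1) :=
    memLp_one_iff_integrable.1 (memLp_id_gaussianReal' 1 ENNReal.one_ne_top)
  exact (measurePreserving_eval (fun _ : κ => gaussianReal 0 1) k).integrable_comp_of_integrable hid

section GaussPi

variable {κ : Type*} [Fintype κ] [DecidableEq κ]

lemma measurePreserving_update_stdGaussPi (k : κ) :
    MeasurePreserving (fun p : (κ → ℝ) × ℝ => Function.update p.1 k p.2)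
      ((stdGaussPi κ).prod (gaussianReal 0 1)) (stdGaussPi κ) := by
  have hmeas : Measurable fun p : (κ → ℝ) × ℝ => Function.update p.1 k p.2 := by
    refine measurable_pi_iff.2 fun i => ?_
    by_cases h : i = k
    · subst h; simpa using measurable_snd
    · simp only [Function.update_of_ne h]
      fun_prop
  refine ⟨hmeas, (Measure.pi_eq fun s hs => ?_).symm⟩
  rw [Measure.map_apply hmeas (MeasurableSet.univ_pi hs)]
  have hset : (fun p : (κ → ℝ) × ℝ => Function.update p.1 k p.2) ⁻¹' Set.univ.pi s =
      (Set.univ.pi (Function.update s k Set.univ)) ×ˢ s k := by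
    ext ⟨x, y⟩
    simp only [Set.mem_preimage, Set.mem_univ_pi, Set.mem_prod]
    constructor
    · intro h
      refine ⟨fun i => ?_, by simpa using h k⟩
      by_cases hi : i = k
      · subst hi; simp
      · simpa [Function.update_of_ne hi] using h i
    · rintro ⟨h1, h2⟩ i
      by_cases hi : i = k
      · subst hi; simpa using h2
      · simpa [Function.update_of_ne hi] using h1 i
  rw [hset, Measure.prod_prod, stdGaussPi, Measure.pi_pi,
    ← Finset.mul_prod_erase Finset.univ _ (Finset.mem_univ k),
    ← Finset.mul_prod_erase Finset.univ (fun i => gaussianReal 0 1 (s i)) (Finset.mem_univ k)]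
  simp only [Function.update_self, measure_univ, one_mul]
  rw [mul_comm]
  congr 1
  refine Finset.prod_congr rfl fun i hi => ?_
  rw [Function.update_of_ne (Finset.ne_of_mem_erase hi)]

/-- Gaussian integration by parts for the standard Gaussian measure on `κ → ℝ`. -/
lemma integral_eval_mul_stdGaussPi (k : κ) {φ φ' : (κ → ℝ) → ℝ} {C C' : ℝ}
    (hd : ∀ x, HasDerivAt (fun y => φ (Function.update x k y)) (φ' x) (x k))
    (hφ : Continuous φ) (hφ' : Continuous φ') (hC : ∀ x, |φ x| ≤ C) (hC' : ∀ x, |φ' x| ≤ C') :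
    ∫ x, x k * φ x ∂stdGaussPi κ = ∫ x, φ' x ∂stdGaussPi κ := by
  have hmp := measurePreserving_update_stdGaussPi k
  have h_int' : Integrable φ' (stdGaussPi κ) :=
    Integrable.of_bound hφ'.aestronglyMeasurable C' (ae_of_all _ fun x => by simpa using hC' x)
  have h_int : Integrable (fun x => x k * φ x) (stdGaussPi κ) :=
    (integrable_eval_stdGaussPi k).mul_bdd hφ.aestronglyMeasurable
      (ae_of_all _ fun x => by simpa using hC x)
  rw [← hmp.map_eq, integral_map hmp.measurable.aemeasurable
      (by rw [hmp.map_eq]; exact h_int.aestronglyMeasurable),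
    integral_map hmp.measurable.aemeasurable
      (by rw [hmp.map_eq]; exact h_int'.aestronglyMeasurable),
    integral_prod (fun p : (κ → ℝ) × ℝ => Function.update p.1 k p.2 k *
      φ (Function.update p.1 k p.2)) (hmp.integrable_comp_of_integrable h_int),
    integral_prod (fun p : (κ → ℝ) × ℝ => φ' (Function.update p.1 k p.2))
      (hmp.integrable_comp_of_integrable h_int')]
  congr 1
  ext x
  simp only [Function.update_self]
  refine integral_id_mul_gaussianReal (C := C) (C' := C') (fun y => ?_) ?_ (fun y => hC _)
    fun y => hC' _
  · simpa using hd (Function.update x k y)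
  · exact (hφ'.comp (continuous_const.update k continuous_id)).measurable

end GaussPi

/-- The Gaussian energy `∑ₖ (cₖ(ρ) + √s dₖ(ρ)) xₖ`. -/
def linEnergy {S κ : Type*} [Fintype κ] (c d : S → κ → ℝ) (s : ℝ) (x : κ → ℝ) (ρ : S) : ℝ :=
  ∑ k, (c ρ k + √s * d ρ k) * x k

/-- The generator `½ ∑ₖ D_{dₖ} D_{dₖ}` acting on functions of replicas. -/
def replicaLap {S κ : Type*} [Fintype κ] {n : ℕ} (d : S → κ → ℝ) (f : (Fin n → S) → ℝ)
    (ρ : Fin (n + 2) → S) : ℝ :=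
  ∑ k, 1 / 2 * replicaDiff (fun a => d a k) (replicaDiff (fun a => d a k) f) ρ

section Interpolation

variable {S κ : Type*} [Fintype S] [Nonempty S] [Fintype κ]

lemma replicaAvg_sum_mul {S ι : Type*} [Fintype S] [Fintype ι] {n : ℕ} (E : S → ℝ) (a : ι → ℝ)
    (F : ι → (Fin n → S) → ℝ) :
    replicaAvg E (fun ρ => ∑ k, a k * F k ρ) = ∑ k, a k * replicaAvg E (F k) := by
  simp only [replicaAvg, Finset.sum_mul, Finset.mul_sum]
  rw [Finset.sum_comm]
  simp only [mul_assoc]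

lemma replicaDiff_sum_mul {S ι : Type*} [Fintype ι] {n : ℕ} (a : ι → ℝ) (u : ι → S → ℝ)
    (f : (Fin n → S) → ℝ) :
    replicaDiff (fun ρ => ∑ k, a k * u k ρ) f = fun ρ => ∑ k, a k * replicaDiff (u k) f ρ := by
  ext ρ
  simp only [replicaDiff]
  rw [Finset.sum_comm, Finset.mul_sum, ← Finset.sum_sub_distrib, Finset.mul_sum]
  refine Finset.sum_congr rfl fun k _ => ?_
  rw [← Finset.mul_sum]
  ring

lemma replicaDiff_add_mul_replicaDiff {S : Type*} {n : ℕ} {u v : S → ℝ}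
    (huv : ∀ ρ ρ', u ρ * v ρ' = 0) (r : ℝ) (f : (Fin n → S) → ℝ) :
    replicaDiff (fun ρ => u ρ + r * v ρ) (replicaDiff v f) =
      fun ρ => r * replicaDiff v (replicaDiff v f) ρ := by
  ext ρ
  have h : ∀ a, u a * (∑ l : Fin n, v (Fin.tail ρ l.succ) - n * v (Fin.tail ρ 0)) = 0 := by
    intro a
    rw [mul_sub, Finset.mul_sum, mul_left_comm]
    simp [huv]
  have h' : (∑ l : Fin (n + 1), u (ρ l.succ) - (n + 1 : ℕ) * u (ρ 0)) *
      (∑ l : Fin n, v (Fin.tail ρ l.succ) - n * v (Fin.tail ρ 0)) = 0 := by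
    rw [sub_mul, Finset.sum_mul, mul_assoc, h]
    simp [h]
  simp only [replicaDiff, Finset.sum_add_distrib, ← Finset.mul_sum]
  linear_combination f (Fin.tail (Fin.tail ρ)) * h'

lemma continuous_linEnergy {S κ : Type*} [Fintype κ] (c d : S → κ → ℝ) (s : ℝ) :
    Continuous fun x => linEnergy c d s x := by
  unfold linEnergy
  fun_prop

lemma integrable_replicaAvg_linEnergy {n : ℕ} (c d : S → κ → ℝ) (s : ℝ)
    (f : (Fin n → S) → ℝ) :
    Integrable (fun x => replicaAvg (linEnergy c d s x) f) (stdGaussPi κ) :=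
  Integrable.of_bound
    ((continuous_replicaAvg f).comp (continuous_linEnergy c d s)).aestronglyMeasurable
    (∑ ρ, |f ρ|) (ae_of_all _ fun _ => abs_replicaAvg_le _ f)

/-- The expectation over the disorder of the Gibbs average of a function of `n` replicas, as a
linear functional. -/
def gaussAvg (c d : S → κ → ℝ) (s : ℝ) (n : ℕ) : ((Fin n → S) → ℝ) →ₗ[ℝ] ℝ where
  toFun f := ∫ x, replicaAvg (linEnergy c d s x) f ∂stdGaussPi κ
  map_add' f g := by
    rw [← integral_add (integrable_replicaAvg_linEnergy c d s f)
      (integrable_replicaAvg_linEnergy c d s g)]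
    simp only [replicaAvg, Pi.add_apply, add_mul, Finset.sum_add_distrib]
  map_smul' a f := by
    rw [RingHom.id_apply, smul_eq_mul, ← integral_const_mul]
    simp only [replicaAvg, Pi.smul_apply, smul_eq_mul, mul_assoc, Finset.mul_sum]

lemma gaussAvg_apply (c d : S → κ → ℝ) (s : ℝ) {n : ℕ} (f : (Fin n → S) → ℝ) :
    gaussAvg c d s n f = ∫ x, replicaAvg (linEnergy c d s x) f ∂stdGaussPi κ := rfl

lemma gaussAvg_mono (c d : S → κ → ℝ) (s : ℝ) {n : ℕ} {f g : (Fin n → S) → ℝ}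
    (h : ∀ ρ, f ρ ≤ g ρ) : gaussAvg c d s n f ≤ gaussAvg c d s n g :=
  integral_mono (integrable_replicaAvg_linEnergy c d s f)
    (integrable_replicaAvg_linEnergy c d s g) fun _ => Finset.sum_le_sum fun ρ _ =>
      mul_le_mul_of_nonneg_right (h ρ) (Finset.prod_nonneg fun _ _ => gibbsProb_nonneg _ _)

lemma abs_gaussAvg_le (c d : S → κ → ℝ) (s : ℝ) {n : ℕ} {f g : (Fin n → S) → ℝ}
    (h : ∀ ρ, |f ρ| ≤ g ρ) : |gaussAvg c d s n f| ≤ gaussAvg c d s n g := by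
  refine abs_le.2 ⟨?_, gaussAvg_mono c d s fun ρ => (le_abs_self _).trans (h ρ)⟩
  rw [← map_neg]
  exact gaussAvg_mono c d s fun ρ => neg_le.1 ((neg_le_abs _).trans (h ρ))

lemma gaussAvg_const (c d : S → κ → ℝ) (s : ℝ) (n : ℕ) (a : ℝ) :
    gaussAvg c d s n (fun _ => a) = a := by
  have h : ∀ E : S → ℝ, replicaAvg E (fun _ : Fin n → S => a) = a := by
    intro E
    have h1 := replicaAvg_prod E (fun (_ : Fin n) (_ : S) => (1 : ℝ))
    simp only [one_mul, sum_gibbsProb, Finset.prod_const_one] at h1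
    have h2 := replicaAvg_sum_mul E (fun _ : Unit => a) (fun _ (_ : Fin n → S) => (1 : ℝ))
    simpa [h1] using h2
  simp [gaussAvg_apply, h]

lemma gaussAvg_tail (c d : S → κ → ℝ) (s : ℝ) {n : ℕ} (f : (Fin n → S) → ℝ) :
    gaussAvg c d s (n + 1) (fun ρ => f (Fin.tail ρ)) = gaussAvg c d s n f := by
  simp only [gaussAvg_apply, replicaAvg_tail]

/-- Gaussian integration by parts for a replica average. -/
lemma integral_eval_mul_replicaAvg [DecidableEq κ] {c d : S → κ → ℝ}
    (hcd : ∀ ρ ρ' k, c ρ k * d ρ' k = 0) (s : ℝ) {n : ℕ} (f : (Fin n → S) → ℝ) (k : κ) :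
    ∫ x, x k * replicaAvg (linEnergy c d s x) (replicaDiff (fun a => d a k) f) ∂stdGaussPi κ =
      √s * gaussAvg c d s (n + 2)
        (replicaDiff (fun a => d a k) (replicaDiff (fun a => d a k) f)) := by
  set g := replicaDiff (fun a => d a k) f
  have hd : ∀ x, HasDerivAt
      (fun y => replicaAvg (linEnergy c d s (Function.update x k y)) g)
      (replicaAvg (linEnergy c d s x) (replicaDiff (fun ρ => c ρ k + √s * d ρ k) g)) (x k) := by
    intro x
    have h := hasDerivAt_replicaAvg (S := S) (u := fun ρ => c ρ k + √s * d ρ k) (θ := x k)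
      (E := fun y => linEnergy c d s (Function.update x k y)) (fun ρ => ?_) g
    · simpa using h
    · have h1 : (fun y => linEnergy c d s (Function.update x k y) ρ) = fun y =>
          (c ρ k + √s * d ρ k) * y +
            ∑ j ∈ Finset.univ.erase k, (c ρ j + √s * d ρ j) * x j := by
        ext y
        rw [linEnergy, ← Finset.add_sum_erase _ _ (Finset.mem_univ k)]
        congr 1
        · simp
        · refine Finset.sum_congr rfl fun j hj => ?_
          rw [Function.update_of_ne (Finset.ne_of_mem_erase hj)]
      rw [h1]
      simpa using ((hasDerivAt_id (x k)).const_mul (c ρ k + √s * d ρ k)).add_const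
        (∑ j ∈ Finset.univ.erase k, (c ρ j + √s * d ρ j) * x j)
  refine (integral_eval_mul_stdGaussPi k hd
    ((continuous_replicaAvg g).comp (continuous_linEnergy c d s))
    ((continuous_replicaAvg _).comp (continuous_linEnergy c d s))
    (fun x => abs_replicaAvg_le _ _) (fun x => abs_replicaAvg_le _ _)).trans ?_
  rw [← smul_eq_mul, ← map_smul, gaussAvg_apply]
  congr 1
  ext x
  refine congrArg (replicaAvg (linEnergy c d s x)) ?_
  exact replicaDiff_add_mul_replicaDiff (fun ρ ρ' => hcd ρ ρ' k) _ f

/-- Derivative of the averaged replica functional along the interpolation. -/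
lemma hasDerivAt_gaussAvg {c d : S → κ → ℝ} (hcd : ∀ ρ ρ' k, c ρ k * d ρ' k = 0) {s : ℝ}
    (hs : 0 < s) {n : ℕ} (f : (Fin n → S) → ℝ) :
    HasDerivAt (fun s' => gaussAvg c d s' n f)
      (gaussAvg c d s (n + 2) (replicaLap d f)) s := by
  classical
  have hpoint : ∀ s' : ℝ, 0 < s' → ∀ x, HasDerivAt (fun r => replicaAvg (linEnergy c d r x) f)
      (∑ k, 1 / (2 * √s') * (x k *
        replicaAvg (linEnergy c d s' x) (replicaDiff (fun a => d a k) f))) s' := by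
    intro s' hs' x
    have h := hasDerivAt_replicaAvg (S := S) (u := fun ρ => ∑ k, (1 / (2 * √s') * x k) * d ρ k)
      (θ := s') (E := fun r => linEnergy c d r x) (fun ρ => ?_) f
    · rw [replicaDiff_sum_mul (fun k => 1 / (2 * √s') * x k) (fun k ρ => d ρ k),
        replicaAvg_sum_mul] at h
      simpa only [mul_assoc] using h
    · refine HasDerivAt.fun_sum fun k _ => ?_
      refine ((((hasDerivAt_sqrt hs'.ne').mul_const (d ρ k)).const_add (c ρ k)).mul_const
        (x k)).congr_deriv ?_
      ring
  have h_int : ∀ k, Integrable (fun x : κ → ℝ => x k *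
      replicaAvg (linEnergy c d s x) (replicaDiff (fun a => d a k) f)) (stdGaussPi κ) := fun k =>
    (integrable_eval_stdGaussPi k).mul_bdd
      ((continuous_replicaAvg _).comp (continuous_linEnergy c d s)).aestronglyMeasurable
      (ae_of_all _ fun x => abs_replicaAvg_le _ _)
  have hmain := (hasDerivAt_integral_of_dominated_loc_of_deriv_le (μ := stdGaussPi κ)
    (F := fun r x => replicaAvg (linEnergy c d r x) f)
    (F' := fun r x => ∑ k, 1 / (2 * √r) * (x k *
        replicaAvg (linEnergy c d r x) (replicaDiff (fun a => d a k) f)))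
    (bound := fun x => ∑ k, 1 / (2 * √(s / 2)) * (|x k| *
        ∑ ρ, |replicaDiff (fun a => d a k) f ρ|))
    (Ioi_mem_nhds (half_lt_self hs))
    (Eventually.of_forall fun r => (integrable_replicaAvg_linEnergy c d r f).aestronglyMeasurable)
    (integrable_replicaAvg_linEnergy c d s f)
    (integrable_finsetSum _ fun k _ => (h_int k).const_mul _).aestronglyMeasurable
    (ae_of_all _ fun x r hr => ?_)
    (integrable_finsetSum _ fun k _ =>
      ((integrable_eval_stdGaussPi k).abs.mul_const _).const_mul _)
    (ae_of_all _ fun x r hr => hpoint r ((half_pos hs).trans hr) x)).2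
  · refine hmain.congr_deriv ?_
    rw [integral_finsetSum _ fun k _ => (h_int k).const_mul _]
    have hlap : replicaLap d f = ∑ k, (1 / 2 : ℝ) •
        replicaDiff (fun a => d a k) (replicaDiff (fun a => d a k) f) := by
      ext ρ
      simp [replicaLap]
    rw [hlap, map_sum]
    refine Finset.sum_congr rfl fun k _ => ?_
    rw [integral_const_mul, integral_eval_mul_replicaAvg hcd, map_smul, smul_eq_mul, ← mul_assoc]
    congr 1
    have := (Real.sqrt_pos.2 hs).ne'
    field_simp
  · rw [Real.norm_eq_abs]
    refine (Finset.abs_sum_le_sum_abs _ _).trans (Finset.sum_le_sum fun k _ => ?_)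
    have hs2 : 0 < √(s / 2) := Real.sqrt_pos.2 (half_pos hs)
    have hr' : s / 2 < r := hr
    have hle : √(s / 2) ≤ √r := Real.sqrt_le_sqrt hr'.le
    have hr0 : 0 < √r := hs2.trans_le hle
    rw [abs_mul, abs_mul, abs_of_pos (by positivity)]
    gcongr
    exact abs_replicaAvg_le _ _

end Interpolation

/-- The coefficients `(-n, 1, …, 1)` of the replicas in `replicaDiff`. -/
def replicaCoeff (n : ℕ) : Fin (n + 1) → ℝ := Fin.cons (-(n : ℝ)) fun _ => 1

lemma sum_replicaCoeff (n : ℕ) : ∑ l, replicaCoeff n l = 0 := by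
  simp [replicaCoeff, Fin.sum_univ_succ]

lemma replicaCoeff_succ (n : ℕ) (l : Fin n) : replicaCoeff n l.succ = 1 := by
  simp [replicaCoeff]

lemma abs_replicaCoeff_le (n : ℕ) (l : Fin (n + 1)) : |replicaCoeff n l| ≤ n + 1 := by
  refine Fin.cases ?_ (fun l => ?_) l
  · simp [replicaCoeff]
  · simp [replicaCoeff]

section Generator

variable {S κ : Type*} [Fintype κ]

lemma replicaDiff_eq {n : ℕ} (u : S → ℝ) (f : (Fin n → S) → ℝ) (ρ : Fin (n + 1) → S) :
    replicaDiff u f ρ = f (Fin.tail ρ) * ∑ l, replicaCoeff n l * u (ρ l) := by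
  simp only [replicaDiff, replicaCoeff, Fin.sum_univ_succ, Fin.cons_zero, Fin.cons_succ, one_mul]
  ring

lemma replicaLap_eq {n : ℕ} (d : S → κ → ℝ) (f : (Fin n → S) → ℝ) (ρ : Fin (n + 2) → S) :
    replicaLap d f ρ = f (Fin.tail (Fin.tail ρ)) * (1 / 2 * ∑ l, ∑ m,
      replicaCoeff n l * replicaCoeff (n + 1) m * ∑ k, d (ρ l.succ) k * d (ρ m) k) := by
  simp only [replicaLap, replicaDiff_eq]
  have h : ∀ k, 1 / 2 * (f (Fin.tail (Fin.tail ρ)) *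
      (∑ l, replicaCoeff n l * d (Fin.tail ρ l) k) *
        ∑ m, replicaCoeff (n + 1) m * d (ρ m) k) =
      f (Fin.tail (Fin.tail ρ)) * (1 / 2 * ∑ l, ∑ m,
        replicaCoeff n l * replicaCoeff (n + 1) m * (d (ρ l.succ) k * d (ρ m) k)) := by
    intro k
    have h2 := Finset.sum_mul_sum Finset.univ Finset.univ
      (fun l => replicaCoeff n l * d (Fin.tail ρ l) k)
      (fun m => replicaCoeff (n + 1) m * d (ρ m) k)
    rw [mul_assoc (f _), h2, mul_left_comm]
    congr 2
    refine Finset.sum_congr rfl fun l _ => Finset.sum_congr rfl fun m _ => ?_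
    simp only [Fin.tail]
    ring
  rw [Finset.sum_congr rfl fun k _ => h k, ← Finset.mul_sum, ← Finset.mul_sum, Finset.sum_comm]
  congr 2
  refine Finset.sum_congr rfl fun l _ => ?_
  rw [Finset.sum_comm]
  simp only [Finset.mul_sum]

/-- A constant part of the diagonal of the covariance does not contribute to the generator. -/
lemma abs_replicaLap_le {n : ℕ} (d : S → κ → ℝ) (f : (Fin n → S) → ℝ) (ρ : Fin (n + 2) → S)
    {c₀ M : ℝ} (hoff : ∀ l m, l ≠ m → |∑ k, d (ρ l) k * d (ρ m) k| ≤ M)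
    (hdiag : ∀ l, |∑ k, d (ρ l) k * d (ρ l) k - c₀| ≤ M) :
    |replicaLap d f ρ| ≤ |f (Fin.tail (Fin.tail ρ))| * ((n + 2) ^ 4 * M) := by
  have hM : 0 ≤ M := (abs_nonneg _).trans (hdiag 0)
  have hzero : ∑ l : Fin (n + 1), ∑ m : Fin (n + 2),
      replicaCoeff n l * replicaCoeff (n + 1) m * (if l.succ = m then c₀ else 0) = 0 := by
    simp only [mul_ite, mul_zero, Finset.sum_ite_eq, Finset.mem_univ, if_true,
      replicaCoeff_succ, mul_one]
    rw [← Finset.sum_mul, sum_replicaCoeff, zero_mul]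
  have hterm : ∀ (l : Fin (n + 1)) (m : Fin (n + 2)),
      |replicaCoeff n l * replicaCoeff (n + 1) m * (∑ k, d (ρ l.succ) k * d (ρ m) k -
        if l.succ = m then c₀ else 0)| ≤ (n + 2) * (n + 2) * M := by
    intro l m
    have h1 : |replicaCoeff n l| ≤ n + 2 := (abs_replicaCoeff_le n l).trans (by linarith)
    have h2 : |replicaCoeff (n + 1) m| ≤ n + 2 :=
      (abs_replicaCoeff_le (n + 1) m).trans (by push_cast; linarith)
    rw [abs_mul, abs_mul]
    gcongr
    split_ifs with h
    · rw [← h]; exact hdiag _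
    · rw [sub_zero]; exact hoff _ _ h
  rw [replicaLap_eq, abs_mul]
  refine mul_le_mul_of_nonneg_left ?_ (abs_nonneg _)
  rw [← sub_zero (∑ l, ∑ m, _), ← hzero, ← Finset.sum_sub_distrib]
  simp only [← Finset.sum_sub_distrib, ← mul_sub]
  rw [abs_mul, abs_of_pos (by norm_num : (0 : ℝ) < 1 / 2)]
  have hsum : |∑ l : Fin (n + 1), ∑ m : Fin (n + 2), replicaCoeff n l * replicaCoeff (n + 1) m *
      (∑ k, d (ρ l.succ) k * d (ρ m) k - if l.succ = m then c₀ else 0)| ≤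
      ∑ l : Fin (n + 1), ∑ m : Fin (n + 2), ((n + 2) * (n + 2) * M : ℝ) :=
    (Finset.abs_sum_le_sum_abs _ _).trans (Finset.sum_le_sum fun l _ =>
      (Finset.abs_sum_le_sum_abs _ _).trans (Finset.sum_le_sum fun m _ => hterm l m))
  simp only [Finset.sum_const, Finset.card_univ, Fintype.card_fin, nsmul_eq_mul] at hsum
  push_cast at hsum
  have h3 : ((n : ℝ) + 1) * ((n + 2) * ((n + 2) * (n + 2) * M)) ≤ (n + 2) ^ 4 * M := by
    have : 0 ≤ ((n : ℝ) + 2) * ((n + 2) * (n + 2) * M) := by positivity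
    nlinarith
  have h4 := abs_nonneg (∑ l : Fin (n + 1), ∑ m : Fin (n + 2),
    replicaCoeff n l * replicaCoeff (n + 1) m *
      (∑ k, d (ρ l.succ) k * d (ρ m) k - if l.succ = m then c₀ else 0))
  linarith

variable [Fintype S] [Nonempty S]

/-- Averages of nonnegative functions along the interpolation are controlled by the endpoint. -/
lemma gaussAvg_le_exp_mul {c d : S → κ → ℝ} (hcd : ∀ ρ ρ' k, c ρ k * d ρ' k = 0) {M : ℝ}
    (hM : ∀ ρ ρ', |∑ k, d ρ k * d ρ' k| ≤ M) {n : ℕ} {f : (Fin n → S) → ℝ} (hf : ∀ ρ, 0 ≤ f ρ)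
    {s : ℝ} (hs : 0 < s) (hs1 : s ≤ 1) :
    gaussAvg c d s n f ≤ Real.exp ((n + 2) ^ 4 * M) * gaussAvg c d 1 n f := by
  set A : ℝ := (n + 2) ^ 4 * M with hA
  have hM0 : 0 ≤ M := (abs_nonneg _).trans (hM (Classical.arbitrary S) (Classical.arbitrary S))
  have hA0 : 0 ≤ A := by positivity
  have hderiv : ∀ r : ℝ, 0 < r → HasDerivAt (fun r => Real.exp (A * r) * gaussAvg c d r n f)
      (Real.exp (A * r) * (A * gaussAvg c d r n f +
        gaussAvg c d r (n + 2) (replicaLap d f))) r := by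
    intro r hr
    have h1 := (((hasDerivAt_id r).const_mul A).exp).mul (hasDerivAt_gaussAvg hcd hr f)
    refine h1.congr_deriv ?_
    simp only [id]
    ring
  have hnonneg : ∀ r : ℝ, 0 ≤ A * gaussAvg c d r n f +
      gaussAvg c d r (n + 2) (replicaLap d f) := by
    intro r
    have h1 : |gaussAvg c d r (n + 2) (replicaLap d f)| ≤
        gaussAvg c d r (n + 2) (A • fun ρ => f (Fin.tail (Fin.tail ρ))) := by
      refine abs_gaussAvg_le c d r fun ρ => ?_
      have h2 := abs_replicaLap_le d f ρ (c₀ := 0) (M := M) (fun l m _ => hM _ _)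
        fun l => by simpa using hM (ρ l) (ρ l)
      rw [abs_of_nonneg (hf _)] at h2
      simpa [hA, mul_comm] using h2
    rw [map_smul, smul_eq_mul, gaussAvg_tail c d r (fun ρ => f (Fin.tail ρ)),
      gaussAvg_tail] at h1
    linarith [neg_abs_le (gaussAvg c d r (n + 2) (replicaLap d f))]
  have hmono : MonotoneOn (fun r => Real.exp (A * r) * gaussAvg c d r n f) (Set.Icc s 1) := by
    refine monotoneOn_of_deriv_nonneg (convex_Icc s 1)
      (fun r hr => (hderiv r (hs.trans_le hr.1)).continuousAt.continuousWithinAt)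
      (fun r hr => ?_) fun r hr => ?_
    · rw [interior_Icc] at hr
      exact (hderiv r (hs.trans hr.1)).differentiableAt.differentiableWithinAt
    · rw [interior_Icc] at hr
      rw [(hderiv r (hs.trans hr.1)).deriv]
      exact mul_nonneg (Real.exp_nonneg _) (hnonneg r)
  have h0 : 0 ≤ gaussAvg c d s n f := by
    have := gaussAvg_mono c d s (f := fun _ => (0 : ℝ)) (g := f) hf
    rwa [gaussAvg_const] at this
  have hend := hmono (Set.left_mem_Icc.2 hs1) (Set.right_mem_Icc.2 hs1) hs1
  simp only [mul_one] at hend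
  refine le_trans ?_ hend
  exact le_mul_of_one_le_left h0 (Real.one_le_exp (mul_nonneg hA0 hs.le))

/-- Hölder's inequality for the averaged replica functional. -/
lemma gaussAvg_prod_rpow_le {c d : S → κ → ℝ} {s : ℝ} {n : ℕ} {ι : Type*} [Fintype ι]
    {h : ι → (Fin n → S) → ℝ} {w B : ι → ℝ} (hh : ∀ i ρ, 0 ≤ h i ρ) (hw : ∀ i, 0 ≤ w i)
    (hw1 : ∑ i, w i = 1) (hB : ∀ i, 0 < B i) (hle : ∀ i, gaussAvg c d s n (h i) ≤ B i) :
    gaussAvg c d s n (fun ρ => ∏ i, h i ρ ^ w i) ≤ ∏ i, B i ^ w i := by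
  have hP : 0 ≤ ∏ i, B i ^ w i := Finset.prod_nonneg fun i _ => (Real.rpow_pos_of_pos (hB i) _).le
  have hpt : ∀ ρ, ∏ i, h i ρ ^ w i ≤
      ((∏ i, B i ^ w i) • ∑ i, (w i / B i) • h i) ρ := by
    intro ρ
    have h1 := Real.geom_mean_le_arith_mean_weighted Finset.univ w (fun i => h i ρ / B i)
      (fun i _ => hw i) hw1 (fun i _ => div_nonneg (hh i ρ) (hB i).le)
    have h2 : ∏ i, h i ρ ^ w i = (∏ i, B i ^ w i) * ∏ i, (h i ρ / B i) ^ w i := by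
      rw [← Finset.prod_mul_distrib]
      refine Finset.prod_congr rfl fun i _ => ?_
      rw [← Real.mul_rpow (hB i).le (div_nonneg (hh i ρ) (hB i).le),
        mul_div_cancel₀ _ (hB i).ne']
    rw [h2]
    simp only [Pi.smul_apply, Finset.sum_apply, smul_eq_mul]
    refine mul_le_mul_of_nonneg_left (h1.trans (le_of_eq ?_)) hP
    refine Finset.sum_congr rfl fun i _ => ?_
    ring
  refine (gaussAvg_mono c d s hpt).trans ?_
  rw [map_smul, map_sum, smul_eq_mul]
  refine mul_le_of_le_one_right hP ?_
  rw [← hw1]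
  refine Finset.sum_le_sum fun i _ => ?_
  rw [map_smul, smul_eq_mul, div_mul_eq_mul_div]
  exact div_le_of_le_mul₀ (hB i).le (hw i) (mul_le_mul_of_nonneg_left (hle i) (hw i))

end Generator

/-- The coefficient of `g p` in the cavity field of `σ`. -/
def fieldCoeff (N : ℕ) (β : ℝ) (σ : Config N) (p : Fin N × Fin N) : ℝ :=
  if (p.1 : ℕ) < N - 1 ∧ (p.2 : ℕ) = N - 1 then β / √N * spin (σ p.1) * spin (σ p.2) else 0

/-- The coefficient of `g p` in the cavity Hamiltonian of `σ`. -/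
def cavCoeff (N : ℕ) (β : ℝ) (σ : Config N) (p : Fin N × Fin N) : ℝ :=
  if p.1 < p.2 ∧ (p.2 : ℕ) < N - 1 then β / √N * spin (σ p.1) * spin (σ p.2) else 0

/-- The coefficients, with respect to the disorder `(g, g', g'')`, of the sum of two copies of a
Gaussian linear form with correlation parameter `t`. -/
def coupledCoeff {X I : Type*} (a : X → I → ℝ) (t : ℝ) (ρ : X × X) : I ⊕ (I ⊕ I) → ℝ :=
  Sum.elim (fun p => √t * (a ρ.1 p + a ρ.2 p))
    (Sum.elim (fun p => √(1 - t) * a ρ.1 p) fun p => √(1 - t) * a ρ.2 p)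

/-- The averages `E⟨·⟩_{t,s}` of functions of `n` pairs as a linear functional. -/
def skAvg (N : ℕ) (β t s : ℝ) (n : ℕ) : ((Fin n → Config N × Config N) → ℝ) →ₗ[ℝ] ℝ :=
  gaussAvg (coupledCoeff (cavCoeff N β) t) (coupledCoeff (fieldCoeff N β) t) s n

lemma spin_mul_self (b : Bool) : spin b * spin b = 1 := by
  cases b <;> simp [spin]

lemma abs_spin (b : Bool) : |spin b| = 1 := by
  cases b <;> simp [spin]

lemma cavCoeff_mul_fieldCoeff (N : ℕ) (β : ℝ) (σ σ' : Config N) (p : Fin N × Fin N) :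
    cavCoeff N β σ p * fieldCoeff N β σ' p = 0 := by
  unfold cavCoeff fieldCoeff
  split_ifs <;> first | omega | simp

lemma coupledCoeff_mul_eq_zero {X I : Type*} {a b : X → I → ℝ}
    (h : ∀ σ σ' p, a σ p * b σ' p = 0) (t : ℝ) (ρ ρ' : X × X) (k : I ⊕ (I ⊕ I)) :
    coupledCoeff a t ρ k * coupledCoeff b t ρ' k = 0 := by
  rcases k with p | p | p
  · simp only [coupledCoeff, Sum.elim_inl]
    linear_combination √t * √t * (h ρ.1 ρ'.1 p + h ρ.1 ρ'.2 p + h ρ.2 ρ'.1 p + h ρ.2 ρ'.2 p)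
  · simp only [coupledCoeff, Sum.elim_inr, Sum.elim_inl]
    linear_combination √(1 - t) * √(1 - t) * h ρ.1 ρ'.1 p
  · simp only [coupledCoeff, Sum.elim_inr]
    linear_combination √(1 - t) * √(1 - t) * h ρ.2 ρ'.2 p

lemma sum_coupledCoeff_mul {X I : Type*} [Fintype I] (a : X → I → ℝ) {t : ℝ}
    (ht : t ∈ Set.Icc (0 : ℝ) 1) (ρ ρ' : X × X) :
    ∑ k, coupledCoeff a t ρ k * coupledCoeff a t ρ' k =
      (∑ p, a ρ.1 p * a ρ'.1 p + ∑ p, a ρ.2 p * a ρ'.2 p) +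
        t * (∑ p, a ρ.1 p * a ρ'.2 p + ∑ p, a ρ.2 p * a ρ'.1 p) := by
  have h1 := Real.mul_self_sqrt ht.1
  have h2 := Real.mul_self_sqrt (sub_nonneg.2 ht.2)
  simp only [Fintype.sum_sum_type, coupledCoeff, Sum.elim_inl, Sum.elim_inr]
  simp only [Finset.mul_sum, ← Finset.sum_add_distrib]
  refine Finset.sum_congr rfl fun p _ => ?_
  linear_combination (a ρ.1 p + a ρ.2 p) * (a ρ'.1 p + a ρ'.2 p) * h1 +
    (a ρ.1 p * a ρ'.1 p + a ρ.2 p * a ρ'.2 p) * h2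

lemma sum_fieldCoeff_mul {N : ℕ} (hN : 1 ≤ N) (β : ℝ) (σ σ' : Config N) :
    ∑ p, fieldCoeff N β σ p * fieldCoeff N β σ' p =
      β ^ 2 * (spinLast σ * spinLast σ' * ovlpm N σ σ') := by
  obtain ⟨M, rfl⟩ : ∃ M, N = M + 1 := ⟨N - 1, by omega⟩
  have hlast : ∀ τ : Config (M + 1), spinLast τ = spin (τ (Fin.last M)) := fun τ => by
    simp [spinLast, Fin.last]
  rw [hlast, hlast, ovlpm, Fintype.sum_prod_type, Finset.sum_filter, mul_div_assoc',
    mul_div_assoc', Finset.mul_sum, Finset.mul_sum, Finset.sum_div]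
  refine Finset.sum_congr rfl fun i _ => ?_
  rw [Finset.sum_eq_single (Fin.last M)]
  · have hs : β / √((M + 1 : ℕ) : ℝ) * (β / √((M + 1 : ℕ) : ℝ)) = β ^ 2 / ((M + 1 : ℕ) : ℝ) := by
      rw [div_mul_div_comm, Real.mul_self_sqrt (by positivity), sq]
    simp only [fieldCoeff, Nat.add_sub_cancel, Fin.val_last, and_true]
    split_ifs
    · linear_combination spin (σ i) * spin (σ (Fin.last M)) * spin (σ' i) *
        spin (σ' (Fin.last M)) * hs
    · simp
  · intro j _ hj
    have : (j : ℕ) ≠ M := fun h => hj (Fin.ext h)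
    simp [fieldCoeff, this]
  · simp

lemma hamCav_eq_sum (N : ℕ) (β : ℝ) (g : Fin N × Fin N → ℝ) (σ : Config N) :
    hamCav N β g σ = ∑ p, cavCoeff N β σ p * g p := by
  rw [hamCav, Finset.sum_filter, Finset.mul_sum]
  refine Finset.sum_congr rfl fun p _ => ?_
  unfold cavCoeff
  split_ifs <;> ring

lemma cavField_eq_sum {N : ℕ} (hN : 1 ≤ N) (β t : ℝ) (g g' : Fin N × Fin N → ℝ) (σ : Config N) :
    cavField N β t g g' σ = ∑ p, fieldCoeff N β σ p * (√t * g p + √(1 - t) * g' p) := by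
  obtain ⟨M, rfl⟩ : ∃ M, N = M + 1 := ⟨N - 1, by omega⟩
  have hl : (⟨M + 1 - 1, Nat.sub_lt hN Nat.one_pos⟩ : Fin (M + 1)) = Fin.last M := rfl
  rw [cavField, dif_pos (by omega), Fintype.sum_prod_type, Finset.sum_filter, Finset.mul_sum]
  refine Finset.sum_congr rfl fun i _ => ?_
  rw [Finset.sum_eq_single (Fin.last M)]
  · simp only [fieldCoeff, Nat.add_sub_cancel, Fin.val_last, and_true]
    split_ifs
    · simp only [Fin.last]
      ring
    · simp
  · intro j _ hj
    have : (j : ℕ) ≠ M := fun h => hj (Fin.ext h)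
    simp [fieldCoeff, this]
  · simp

/-- The disorder with law `disM3` read off from coordinates indexed by a disjoint union. -/
def splitDisorder {I : Type*} (x : I ⊕ (I ⊕ I) → ℝ) : (I → ℝ) × (I → ℝ) × (I → ℝ) :=
  (fun p => x (Sum.inl p), fun p => x (Sum.inr (Sum.inl p)), fun p => x (Sum.inr (Sum.inr p)))

lemma measurePreserving_splitDisorder (N : ℕ) :
    MeasurePreserving (splitDisorder (I := Fin N × Fin N)) (stdGaussPi _) (disM3 N) := by
  have h1 := measurePreserving_sumPiEquivProdPi
    (fun _ : (Fin N × Fin N) ⊕ ((Fin N × Fin N) ⊕ (Fin N × Fin N)) => gaussianReal 0 1)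
  have h2 := measurePreserving_sumPiEquivProdPi
    (fun _ : (Fin N × Fin N) ⊕ (Fin N × Fin N) => gaussianReal 0 1)
  exact ((MeasurePreserving.id (gaussPi N)).prod h2).comp h1

lemma linEnergy_eq_hamTS {N : ℕ} (hN : 1 ≤ N) (β t s : ℝ)
    (x : (Fin N × Fin N) ⊕ ((Fin N × Fin N) ⊕ (Fin N × Fin N)) → ℝ) (ρ : Config N × Config N) :
    linEnergy (coupledCoeff (cavCoeff N β) t) (coupledCoeff (fieldCoeff N β) t) s x ρ =
      hamTS N β t s (splitDisorder x).1 (splitDisorder x).2.1 ρ.1 +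
        hamTS N β t s (splitDisorder x).1 (splitDisorder x).2.2 ρ.2 := by
  simp only [linEnergy, hamTS, hamCav_eq_sum, cavField_eq_sum hN, Fintype.sum_sum_type,
    coupledCoeff, Sum.elim_inl, Sum.elim_inr, splitDisorder]
  simp only [Finset.mul_sum, ← Finset.sum_add_distrib]
  refine Finset.sum_congr rfl fun p _ => ?_
  ring

/-- The energy of a pair in the coupled cavity system. -/
def pairEnergy (N : ℕ) (β t s : ℝ)
    (ω : (Fin N × Fin N → ℝ) × (Fin N × Fin N → ℝ) × (Fin N × Fin N → ℝ))
    (ρ : Config N × Config N) : ℝ :=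
  hamTS N β t s ω.1 ω.2.1 ρ.1 + hamTS N β t s ω.1 ω.2.2 ρ.2

lemma continuous_pairEnergy {N : ℕ} (hN : 1 ≤ N) (β t s : ℝ) :
    Continuous fun ω => pairEnergy N β t s ω := by
  unfold pairEnergy hamTS
  simp only [hamCav_eq_sum, cavField_eq_sum hN]
  fun_prop

lemma integrable_replicaAvg_pairEnergy {N : ℕ} (hN : 1 ≤ N) (β t s : ℝ) {n : ℕ}
    (f : (Fin n → Config N × Config N) → ℝ) :
    Integrable (fun ω => replicaAvg (pairEnergy N β t s ω) f) (disM3 N) := by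
  have : IsProbabilityMeasure (disM3 N) := by unfold disM3; infer_instance
  exact Integrable.of_bound
    ((continuous_replicaAvg f).comp (continuous_pairEnergy hN β t s)).aestronglyMeasurable
    (∑ ρ, |f ρ|) (ae_of_all _ fun _ => abs_replicaAvg_le _ f)

lemma skAvg_eq_integral {N : ℕ} (hN : 1 ≤ N) (β t s : ℝ) {n : ℕ}
    (f : (Fin n → Config N × Config N) → ℝ) :
    skAvg N β t s n f = ∫ ω, replicaAvg (pairEnergy N β t s ω) f ∂disM3 N := by
  have hmp := measurePreserving_splitDisorder N
  rw [skAvg, gaussAvg_apply, ← hmp.map_eq, integral_map hmp.measurable.aemeasurable]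
  · congr 1
    ext x
    congr 1
    ext ρ
    exact linEnergy_eq_hamTS hN β t s x ρ
  · rw [hmp.map_eq]
    exact (integrable_replicaAvg_pairEnergy hN β t s f).aestronglyMeasurable

lemma replicaAvg_two {S : Type*} [Fintype S] (E : S → ℝ) (F : S → S → ℝ) :
    replicaAvg E (fun ρ : Fin 2 → S => F (ρ 0) (ρ 1)) =
      (∑ a, ∑ b, F a b * Real.exp (E a) * Real.exp (E b)) / (∑ a, Real.exp (E a)) ^ 2 := by
  rw [replicaAvg, ← (finTwoArrowEquiv S).symm.sum_comp, Fintype.sum_prod_type, Finset.sum_div]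
  refine Finset.sum_congr rfl fun a _ => ?_
  rw [Finset.sum_div]
  refine Finset.sum_congr rfl fun b _ => ?_
  simp only [finTwoArrowEquiv_symm_apply, Fin.prod_univ_two, gibbsProb, Matrix.cons_val_zero,
    Matrix.cons_val_one]
  ring

lemma EgibbsTS2_eq_skAvg {N : ℕ} (hN : 1 ≤ N) (β t s : ℝ)
    (F : Config N × Config N → Config N × Config N → ℝ) :
    EgibbsTS2 N β t s F = skAvg N β t s 2 fun ρ => F (ρ 0) (ρ 1) := by
  rw [skAvg_eq_integral hN, EgibbsTS2]
  simp only [replicaAvg_two]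
  rfl

lemma EgibbsTS1_eq_integral (N : ℕ) (β t s : ℝ) (u : Config N × Config N → ℝ) :
    EgibbsTS1 N β t s u =
      ∫ ω, ∑ ρ, u ρ * gibbsProb (pairEnergy N β t s ω) ρ ∂disM3 N := by
  simp only [sum_mul_gibbsProb]
  rfl

lemma EgibbsTS1_eq_skAvg {N : ℕ} (hN : 1 ≤ N) (β t s : ℝ) (u : Config N × Config N → ℝ) {n : ℕ}
    (l : Fin n) : EgibbsTS1 N β t s u = skAvg N β t s n fun ρ => u (ρ l) := by
  rw [skAvg_eq_integral hN, EgibbsTS1_eq_integral]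
  simp only [replicaAvg_apply]

lemma gibbs2_eq_replicaAvg (N : ℕ) (β : ℝ) (g : Fin N × Fin N → ℝ)
    (F : Config N → Config N → ℝ) :
    gibbs2 N β g F = replicaAvg (ham N β g) fun ρ : Fin 2 → Config N => F (ρ 0) (ρ 1) := by
  rw [replicaAvg_two]
  simp only [gibbs2, Real.exp_add, mul_assoc]
  rfl

/-- The disorder `√t g + √(1-t) g'`. -/
def mixDisorder {I : Type*} (t : ℝ) (g g' : I → ℝ) (p : I) : ℝ := √t * g p + √(1 - t) * g' p

lemma measurePreserving_mix_gaussianReal {t : ℝ} (ht : t ∈ Set.Icc (0 : ℝ) 1) :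
    MeasurePreserving (fun z : ℝ × ℝ => √t * z.1 + √(1 - t) * z.2)
      ((gaussianReal 0 1).prod (gaussianReal 0 1)) (gaussianReal 0 1) := by
  refine ⟨by fun_prop, ?_⟩
  have h1 := gaussianReal_map_const_mul (μ := 0) (v := 1) √t
  have h2 := gaussianReal_map_const_mul (μ := 0) (v := 1) √(1 - t)
  have hconv := gaussianReal_conv_gaussianReal (m₁ := √t * 0) (m₂ := √(1 - t) * 0)
    (v₁ := NNReal.mk (√t ^ 2) (sq_nonneg _) * 1)
    (v₂ := NNReal.mk (√(1 - t) ^ 2) (sq_nonneg _) * 1)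
  have hv : NNReal.mk (√t ^ 2) (sq_nonneg _) * 1 +
      NNReal.mk (√(1 - t) ^ 2) (sq_nonneg _) * 1 = 1 := by
    ext
    simp [Real.sq_sqrt ht.1, Real.sq_sqrt (sub_nonneg.2 ht.2)]
  rw [hv, ← h1, ← h2, Measure.conv,
    Measure.map_prod_map _ _ (by fun_prop) (by fun_prop), Measure.map_map (by fun_prop)
    (by fun_prop)] at hconv
  simpa [Function.comp_def] using hconv

lemma measurePreserving_mixDisorder (N : ℕ) {t : ℝ} (ht : t ∈ Set.Icc (0 : ℝ) 1) :
    MeasurePreserving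
      (fun z : (Fin N × Fin N → ℝ) × (Fin N × Fin N → ℝ) => mixDisorder t z.1 z.2)
      ((gaussPi N).prod (gaussPi N)) (gaussPi N) := by
  have h1 := (measurePreserving_arrowProdEquivProdArrow ℝ ℝ (Fin N × Fin N)
    (fun _ => gaussianReal 0 1) (fun _ => gaussianReal 0 1)).symm
  have h2 := measurePreserving_pi
    (fun _ : Fin N × Fin N => (gaussianReal 0 1).prod (gaussianReal 0 1))
    (fun _ : Fin N × Fin N => gaussianReal 0 1) fun _ => measurePreserving_mix_gaussianReal ht
  exact h2.comp h1

lemma measurePreserving_mix_fst (N : ℕ) {t : ℝ} (ht : t ∈ Set.Icc (0 : ℝ) 1) :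
    MeasurePreserving (fun ω : (Fin N × Fin N → ℝ) × (Fin N × Fin N → ℝ) × (Fin N × Fin N → ℝ) =>
      mixDisorder t ω.1 ω.2.1) (disM3 N) (gaussPi N) :=
  (measurePreserving_mixDisorder N ht).comp
    ((MeasurePreserving.id (gaussPi N)).prod measurePreserving_fst)

lemma measurePreserving_mix_snd (N : ℕ) {t : ℝ} (ht : t ∈ Set.Icc (0 : ℝ) 1) :
    MeasurePreserving (fun ω : (Fin N × Fin N → ℝ) × (Fin N × Fin N → ℝ) × (Fin N × Fin N → ℝ) =>
      mixDisorder t ω.1 ω.2.2) (disM3 N) (gaussPi N) :=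
  (measurePreserving_mixDisorder N ht).comp
    ((MeasurePreserving.id (gaussPi N)).prod measurePreserving_snd)

lemma hamTS_one {N : ℕ} (hN : 1 ≤ N) (β t : ℝ) (g g' : Fin N × Fin N → ℝ) (σ : Config N) :
    hamTS N β t 1 g g' σ = ham N β (mixDisorder t g g') σ := by
  simp only [hamTS, hamCav_eq_sum, cavField_eq_sum hN, ham, Finset.sum_filter, Finset.mul_sum,
    ← Finset.sum_add_distrib]
  refine Finset.sum_congr rfl fun p _ => ?_
  have hp1 := p.1.2
  have hp2 := p.2.2
  simp only [cavCoeff, fieldCoeff, mixDisorder, Real.sqrt_one]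
  by_cases h : p.1 < p.2
  · have hlt : (p.1 : ℕ) < p.2 := h
    by_cases h' : (p.2 : ℕ) < N - 1
    · rw [if_pos ⟨h, h'⟩, if_neg (by omega), if_pos h]
      ring
    · rw [if_neg (by tauto), if_pos (by omega), if_pos h]
      ring
  · have hle : (p.2 : ℕ) ≤ p.1 := not_lt.1 h
    rw [if_neg (by tauto), if_neg (by omega), if_neg h]
    ring

lemma gibbsProb_prod {X Y : Type*} [Fintype X] [Fintype Y] (E₁ : X → ℝ) (E₂ : Y → ℝ) (ρ : X × Y) :
    gibbsProb (fun ρ : X × Y => E₁ ρ.1 + E₂ ρ.2) ρ = gibbsProb E₁ ρ.1 * gibbsProb E₂ ρ.2 := by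
  simp only [gibbsProb, Real.exp_add, Fintype.sum_prod_type]
  rw [div_mul_div_comm, ← Finset.sum_mul_sum]

lemma sum_mul_gibbsProb_prod {X Y : Type*} [Fintype X] [Fintype Y] (E₁ : X → ℝ) (E₂ : Y → ℝ)
    (u : X → ℝ) (v : Y → ℝ) :
    ∑ ρ : X × Y, u ρ.1 * v ρ.2 * gibbsProb (fun ρ : X × Y => E₁ ρ.1 + E₂ ρ.2) ρ =
      (∑ a, u a * gibbsProb E₁ a) * ∑ b, v b * gibbsProb E₂ b := by
  rw [Fintype.sum_prod_type, Finset.sum_mul_sum]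
  refine Finset.sum_congr rfl fun a _ => Finset.sum_congr rfl fun b _ => ?_
  rw [gibbsProb_prod]
  ring

/-- The configuration with index `(l, b)` among the `2n` configurations of `n` pairs. -/
def pairComponent {X : Type*} {n : ℕ} (ρ : Fin n → X × X) (a : Fin n × Bool) : X :=
  if a.2 then (ρ a.1).1 else (ρ a.1).2

/-- Distinct components of independent pairs are independent. -/
lemma replicaAvg_component_mul_component {X : Type*} [Fintype X] [Nonempty X] {n : ℕ}
    (E : Bool → X → ℝ) (u : X → ℝ) {a b : Fin n × Bool} (hab : a ≠ b) :
    replicaAvg (fun ρ : X × X => E true ρ.1 + E false ρ.2)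
        (fun ρ => u (pairComponent ρ a) * u (pairComponent ρ b)) =
      (∑ σ, u σ * gibbsProb (E a.2) σ) * ∑ σ, u σ * gibbsProb (E b.2) σ := by
  obtain ⟨l, i⟩ := a
  obtain ⟨m, j⟩ := b
  have hone : ∀ c, ∑ σ, gibbsProb (E c) σ = 1 := fun c => sum_gibbsProb _
  have hmarg : ∀ c : Bool, ∑ ρ : X × X, u (if c then ρ.1 else ρ.2) *
      gibbsProb (fun ρ : X × X => E true ρ.1 + E false ρ.2) ρ =
        ∑ σ, u σ * gibbsProb (E c) σ := by
    intro c
    cases c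
    · have h := sum_mul_gibbsProb_prod (E true) (E false) (fun _ => 1) u
      simpa [hone] using h
    · have h := sum_mul_gibbsProb_prod (E true) (E false) u (fun _ => 1)
      simpa [hone] using h
  by_cases hlm : l = m
  · subst hlm
    have hprod := sum_mul_gibbsProb_prod (E true) (E false) u u
    have happ := replicaAvg_apply (fun ρ : X × X => E true ρ.1 + E false ρ.2)
      (fun ρ => u ρ.1 * u ρ.2) l
    rw [hprod] at happ
    cases i <;> cases j
    · exact absurd rfl hab
    · simp only [pairComponent, mul_comm (u _) (u _), if_true, if_false, Bool.false_eq_true] at *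
      rw [happ, mul_comm]
    · simpa [pairComponent] using happ
    · exact absurd rfl hab
  · rw [← hmarg, ← hmarg, ← replicaAvg_apply_mul_apply _ _ _ hlm]
    rfl

/-- Product of the spins at the sites listed by `I`. -/
def spinProd {N p : ℕ} (I : Fin p → Fin N) (σ : Config N) : ℝ := ∏ j, spin (σ (I j))

/-- The Gibbs average of a product of spins. -/
def spinMean {N p : ℕ} (E : Config N → ℝ) (I : Fin p → Fin N) : ℝ :=
  ∑ σ, spinProd I σ * gibbsProb E σ

lemma ovlp_pow_eq (N p : ℕ) (σ τ : Config N) :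
    ovlp N σ τ ^ p = ∑ I : Fin p → Fin N, ((N : ℝ) ^ p)⁻¹ * (spinProd I σ * spinProd I τ) := by
  rw [ovlp, div_pow, Fintype.sum_pow, div_eq_inv_mul, Finset.mul_sum]
  simp only [spinProd, Finset.prod_mul_distrib]

lemma replicaAvg_ovlp_pow {N p n : ℕ} (E : Bool → Config N → ℝ) {a b : Fin n × Bool}
    (hab : a ≠ b) :
    replicaAvg (fun ρ : Config N × Config N => E true ρ.1 + E false ρ.2)
        (fun ρ => ovlp N (pairComponent ρ a) (pairComponent ρ b) ^ p) =
      ∑ I : Fin p → Fin N, ((N : ℝ) ^ p)⁻¹ * (spinMean (E a.2) I * spinMean (E b.2) I) := by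
  simp only [ovlp_pow_eq]
  rw [replicaAvg_sum_mul]
  simp only [replicaAvg_component_mul_component E _ hab]
  rfl

lemma gibbs2_ovlp_pow {N p : ℕ} (β : ℝ) (g : Fin N × Fin N → ℝ) :
    gibbs2 N β g (fun σ τ => ovlp N σ τ ^ p) =
      ∑ I : Fin p → Fin N, ((N : ℝ) ^ p)⁻¹ * spinMean (ham N β g) I ^ 2 := by
  rw [gibbs2_eq_replicaAvg]
  simp only [ovlp_pow_eq]
  rw [replicaAvg_sum_mul]
  refine Finset.sum_congr rfl fun I _ => ?_
  rw [replicaAvg_apply_mul_apply _ (spinProd I) (spinProd I) (by decide), sq]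
  rfl

lemma continuous_ham (N : ℕ) (β : ℝ) : Continuous fun g => ham N β g := by
  unfold ham
  fun_prop

lemma integrable_gibbs2 (N : ℕ) (β : ℝ) (F : Config N → Config N → ℝ) :
    Integrable (fun g => gibbs2 N β g F) (gaussPi N) := by
  simp only [gibbs2_eq_replicaAvg]
  exact Integrable.of_bound
    ((continuous_replicaAvg _).comp (continuous_ham N β)).aestronglyMeasurable
    _ (ae_of_all _ fun _ => abs_replicaAvg_le _ _)

lemma pairEnergy_one {N : ℕ} (hN : 1 ≤ N) (β t : ℝ)
    (ω : (Fin N × Fin N → ℝ) × (Fin N × Fin N → ℝ) × (Fin N × Fin N → ℝ)) :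
    pairEnergy N β t 1 ω = fun ρ : Config N × Config N =>
      ham N β (mixDisorder t ω.1 ω.2.1) ρ.1 + ham N β (mixDisorder t ω.1 ω.2.2) ρ.2 := by
  ext ρ
  rw [pairEnergy, hamTS_one hN, hamTS_one hN]

/-- Every moment of an overlap of two components of the coupled system is dominated by the
corresponding moment of the overlap in a single system. -/
lemma skAvg_ovlp_pow_le {N : ℕ} (hN : 1 ≤ N) (β : ℝ) {t : ℝ} (ht : t ∈ Set.Icc (0 : ℝ) 1)
    {n : ℕ} {a b : Fin n × Bool} (hab : a ≠ b) (p : ℕ) :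
    skAvg N β t 1 n (fun ρ => ovlp N (pairComponent ρ a) (pairComponent ρ b) ^ p) ≤
      Egibbs2 N β fun σ τ => ovlp N σ τ ^ p := by
  let G : Bool → ((Fin N × Fin N → ℝ) × (Fin N × Fin N → ℝ) × (Fin N × Fin N → ℝ)) →
      (Fin N × Fin N → ℝ) :=
    fun c ω => if c then mixDisorder t ω.1 ω.2.1 else mixDisorder t ω.1 ω.2.2
  have hG : ∀ c, MeasurePreserving (G c) (disM3 N) (gaussPi N) := by
    intro c
    cases c
    · exact measurePreserving_mix_snd N ht
    · exact measurePreserving_mix_fst N ht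
  have h_int : ∀ c, Integrable (fun ω => gibbs2 N β (G c ω) fun σ τ => ovlp N σ τ ^ p)
      (disM3 N) := fun c => (hG c).integrable_comp_of_integrable (integrable_gibbs2 N β _)
  have hval : ∀ c, ∫ ω, gibbs2 N β (G c ω) (fun σ τ => ovlp N σ τ ^ p) ∂disM3 N =
      Egibbs2 N β fun σ τ => ovlp N σ τ ^ p := by
    intro c
    rw [Egibbs2, ← (hG c).map_eq, integral_map (hG c).measurable.aemeasurable]
    rw [(hG c).map_eq]
    exact (integrable_gibbs2 N β _).aestronglyMeasurable
  rw [skAvg_eq_integral hN]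
  calc _ ≤ ∫ ω, (1 / 2 * gibbs2 N β (G a.2 ω) (fun σ τ => ovlp N σ τ ^ p) +
        1 / 2 * gibbs2 N β (G b.2 ω) (fun σ τ => ovlp N σ τ ^ p)) ∂disM3 N := by
        refine integral_mono (integrable_replicaAvg_pairEnergy hN β t 1 _)
          (((h_int a.2).const_mul _).add ((h_int b.2).const_mul _)) fun ω => ?_
        have h := replicaAvg_ovlp_pow (p := p) (fun c => ham N β (G c ω)) hab
        simp only [pairEnergy_one hN]
        refine (le_of_eq h).trans ?_
        rw [gibbs2_ovlp_pow, gibbs2_ovlp_pow, Finset.mul_sum, Finset.mul_sum,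
          ← Finset.sum_add_distrib]
        refine Finset.sum_le_sum fun I _ => ?_
        have hN' : 0 ≤ ((N : ℝ) ^ p)⁻¹ := by positivity
        nlinarith [mul_nonneg hN' (sq_nonneg (spinMean (ham N β (G a.2 ω)) I -
          spinMean (ham N β (G b.2 ω)) I))]
    _ = _ := by
        rw [integral_add ((h_int a.2).const_mul _) ((h_int b.2).const_mul _), integral_const_mul,
          integral_const_mul, hval, hval]
        ring

lemma spinProd_const {N p : ℕ} (hp : Even p) (i : Fin N) (σ : Config N) :
    spinProd (fun _ : Fin p => i) σ = 1 := by
  obtain ⟨q, rfl⟩ := hp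
  simp [spinProd, pow_add, ← mul_pow, spin_mul_self]

lemma spinMean_const {N p : ℕ} (hp : Even p) (E : Config N → ℝ) (i : Fin N) :
    spinMean E (fun _ : Fin p => i) = 1 := by
  simp [spinMean, spinProd_const hp, sum_gibbsProb]

lemma inv_pow_le_Egibbs2 {N : ℕ} (hN : 1 ≤ N) (β : ℝ) {p : ℕ} (hp : Even p) :
    ((N : ℝ) ^ p)⁻¹ ≤ Egibbs2 N β fun σ τ => ovlp N σ τ ^ p := by
  have h := integral_mono (integrable_const (((N : ℝ) ^ p)⁻¹))
    (integrable_gibbs2 N β fun σ τ => ovlp N σ τ ^ p) fun g => by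
      rw [gibbs2_ovlp_pow]
      refine le_trans ?_ (Finset.single_le_sum (f := fun I : Fin p → Fin N =>
        ((N : ℝ) ^ p)⁻¹ * spinMean (ham N β g) I ^ 2) (fun I _ => by positivity)
        (Finset.mem_univ fun _ => ⟨0, hN⟩))
      simp [spinMean_const hp]
  simpa [Egibbs2] using h

/-- Conditionally on the shared disorder the two systems are independent and identically
distributed, so their correlations are nonnegative. -/
lemma integral_mul_mixDisorder_nonneg (N : ℕ) (t : ℝ) (F : (Fin N × Fin N → ℝ) → ℝ) :
    0 ≤ ∫ ω, F (mixDisorder t ω.1 ω.2.1) * F (mixDisorder t ω.1 ω.2.2) ∂disM3 N := by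
  by_cases h_int : Integrable (fun ω : (Fin N × Fin N → ℝ) × (Fin N × Fin N → ℝ) ×
      (Fin N × Fin N → ℝ) => F (mixDisorder t ω.1 ω.2.1) * F (mixDisorder t ω.1 ω.2.2)) (disM3 N)
  · rw [disM3, integral_prod _ h_int]
    refine integral_nonneg fun g => ?_
    simp only
    rw [integral_prod_mul (fun g' => F (mixDisorder t g g')) (fun g' => F (mixDisorder t g g'))]
    exact mul_self_nonneg _
  · rw [integral_undef h_int]

lemma inv_sq_le_EgibbsTS1 {N : ℕ} (hN : 1 ≤ N) (β t : ℝ) :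
    ((N : ℝ) ^ 2)⁻¹ ≤ EgibbsTS1 N β t 1 fun ρ => ovlp N ρ.1 ρ.2 ^ 2 := by
  have : IsProbabilityMeasure (disM3 N) := by unfold disM3; infer_instance
  have hval : ∀ ω, ∑ ρ, ovlp N ρ.1 ρ.2 ^ 2 * gibbsProb (pairEnergy N β t 1 ω) ρ =
      ∑ I : Fin 2 → Fin N, ((N : ℝ) ^ 2)⁻¹ *
        (spinMean (ham N β (mixDisorder t ω.1 ω.2.1)) I *
          spinMean (ham N β (mixDisorder t ω.1 ω.2.2)) I) := by
    intro ω
    have h1 := replicaAvg_apply (pairEnergy N β t 1 ω) (fun ρ => ovlp N ρ.1 ρ.2 ^ 2) (0 : Fin 1)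
    have h2 := replicaAvg_ovlp_pow (p := 2) (a := ((0 : Fin 1), true)) (b := (0, false))
      (fun c => ham N β (if c then mixDisorder t ω.1 ω.2.1 else mixDisorder t ω.1 ω.2.2))
      (by simp)
    rw [← h1, pairEnergy_one hN]
    exact h2
  have hcont : ∀ I : Fin 2 → Fin N, Continuous fun ω : (Fin N × Fin N → ℝ) ×
      (Fin N × Fin N → ℝ) × (Fin N × Fin N → ℝ) =>
        spinMean (ham N β (mixDisorder t ω.1 ω.2.1)) I *
          spinMean (ham N β (mixDisorder t ω.1 ω.2.2)) I := by
    intro I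
    have h1 : Continuous fun E : Config N → ℝ => spinMean E I := by
      unfold spinMean
      exact continuous_finsetSum _ fun σ _ => continuous_const.mul (continuous_gibbsProb σ)
    have h2 := h1.comp (continuous_ham N β)
    exact (h2.comp (by unfold mixDisorder; fun_prop)).mul
      (h2.comp (by unfold mixDisorder; fun_prop))
  have hbd : ∀ (I : Fin 2 → Fin N) (E : Config N → ℝ), |spinMean E I| ≤ 1 := by
    intro I E
    refine (Finset.abs_sum_le_sum_abs _ _).trans ?_
    rw [← sum_gibbsProb E]
    refine Finset.sum_le_sum fun σ _ => ?_
    simp [spinProd, abs_mul, abs_spin, abs_of_nonneg (gibbsProb_nonneg E σ)]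
  have h_int : ∀ I : Fin 2 → Fin N, Integrable (fun ω : (Fin N × Fin N → ℝ) ×
      (Fin N × Fin N → ℝ) × (Fin N × Fin N → ℝ) =>
        spinMean (ham N β (mixDisorder t ω.1 ω.2.1)) I *
          spinMean (ham N β (mixDisorder t ω.1 ω.2.2)) I) (disM3 N) := fun I =>
    Integrable.of_bound (hcont I).aestronglyMeasurable 1 (ae_of_all _ fun ω => by
      rw [Real.norm_eq_abs, abs_mul]
      exact mul_le_one₀ (hbd _ _) (abs_nonneg _) (hbd _ _))
  rw [EgibbsTS1_eq_integral]
  simp only [hval]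
  rw [integral_finsetSum _ fun I _ => (h_int I).const_mul _]
  simp only [integral_const_mul]
  refine le_trans ?_ (Finset.single_le_sum (f := fun I : Fin 2 → Fin N => ((N : ℝ) ^ 2)⁻¹ *
    ∫ ω, spinMean (ham N β (mixDisorder t ω.1 ω.2.1)) I *
          spinMean (ham N β (mixDisorder t ω.1 ω.2.2)) I ∂disM3 N) (fun I _ => mul_nonneg
      (by positivity) (integral_mul_mixDisorder_nonneg N t fun g => spinMean (ham N β g) I))
      (Finset.mem_univ fun _ => ⟨0, hN⟩))
  simp [spinMean_const even_two]

lemma sq_EgibbsTS1_le {N : ℕ} (hN : 1 ≤ N) (β t s : ℝ) (u : Config N × Config N → ℝ) :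
    EgibbsTS1 N β t s u ^ 2 ≤ EgibbsTS2 N β t s fun ρ₁ ρ₂ => u ρ₁ * u ρ₂ := by
  have : IsProbabilityMeasure (disM3 N) := by unfold disM3; infer_instance
  set A := EgibbsTS1 N β t s u with hA
  have hi1 := integrable_replicaAvg_pairEnergy hN β t s (n := 2) fun ρ => u (ρ 0)
  have hi2 := integrable_replicaAvg_pairEnergy hN β t s (n := 2) fun ρ => u (ρ 0) * u (ρ 1)
  have hA' : A = ∫ ω, replicaAvg (pairEnergy N β t s ω) (fun ρ : Fin 2 → _ => u (ρ 0)) ∂disM3 N := by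
    rw [hA, EgibbsTS1_eq_skAvg hN β t s u (0 : Fin 2), skAvg_eq_integral hN]
  rw [EgibbsTS2_eq_skAvg hN, skAvg_eq_integral hN]
  have h := integral_mono ((hi1.const_mul (2 * A)).sub (integrable_const (A ^ 2))) hi2 fun ω => by
    simp only [Pi.sub_apply]
    rw [replicaAvg_apply_mul_apply _ u u (by decide), replicaAvg_apply]
    nlinarith [sq_nonneg (∑ ρ, u ρ * gibbsProb (pairEnergy N β t s ω) ρ - A)]
  rw [integral_sub' (hi1.const_mul (2 * A)) (integrable_const (A ^ 2)), integral_const_mul,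
    ← hA'] at h
  simp only [integral_const, probReal_univ, one_smul] at h
  linarith

/-- A common upper bound for the absolute values of the overlap and the truncated overlap. -/
def ovlpBound (N : ℕ) (σ τ : Config N) : ℝ := |ovlp N σ τ| + (N : ℝ)⁻¹

lemma ovlpBound_nonneg (N : ℕ) (σ τ : Config N) : 0 ≤ ovlpBound N σ τ := by
  unfold ovlpBound
  positivity

lemma abs_ovlp_le_ovlpBound (N : ℕ) (σ τ : Config N) : |ovlp N σ τ| ≤ ovlpBound N σ τ :=
  le_add_of_nonneg_right (by positivity)

lemma abs_spinLast {N : ℕ} (hN : 1 ≤ N) (σ : Config N) : |spinLast σ| = 1 := by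
  rw [spinLast, dif_pos (by omega), abs_spin]

lemma ovlpm_eq {N : ℕ} (hN : 1 ≤ N) (σ τ : Config N) :
    ovlpm N σ τ = ovlp N σ τ - spinLast σ * spinLast τ / N := by
  obtain ⟨M, rfl⟩ : ∃ M, N = M + 1 := ⟨N - 1, by omega⟩
  have hlast : ∀ τ : Config (M + 1), spinLast τ = spin (τ (Fin.last M)) := fun τ => by
    simp [spinLast, Fin.last]
  rw [hlast, hlast, ovlpm, ovlp, ← sub_div, Finset.sum_filter, Fin.sum_univ_castSucc,
    Fin.sum_univ_castSucc]
  simp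

lemma abs_ovlpm_le {N : ℕ} (hN : 1 ≤ N) (σ τ : Config N) : |ovlpm N σ τ| ≤ ovlpBound N σ τ := by
  rw [ovlpm_eq hN]
  refine (abs_sub _ _).trans ?_
  simp [ovlpBound, abs_div, abs_mul, abs_spinLast hN]

lemma ovlpBound_le_two {N : ℕ} (hN : 1 ≤ N) (σ τ : Config N) : ovlpBound N σ τ ≤ 2 := by
  have hN' : (1 : ℝ) ≤ N := by exact_mod_cast hN
  have h1 : |ovlp N σ τ| ≤ 1 := by
    rw [ovlp, abs_div, Nat.abs_cast, div_le_one (by linarith)]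
    refine (Finset.abs_sum_le_sum_abs _ _).trans ?_
    simp [abs_mul, abs_spin]
  have h2 : (N : ℝ)⁻¹ ≤ 1 := inv_le_one_of_one_le₀ hN'
  unfold ovlpBound
  linarith

lemma ovlpBound_pow_le {N : ℕ} {p : ℕ} (hp : Even p) (σ τ : Config N) :
    ovlpBound N σ τ ^ p ≤ 2 ^ p * (ovlp N σ τ ^ p + ((N : ℝ) ^ p)⁻¹) := by
  have h := add_pow_le (abs_nonneg (ovlp N σ τ)) (inv_nonneg.2 (Nat.cast_nonneg (α := ℝ) N)) p
  rw [hp.pow_abs, inv_pow] at h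
  refine h.trans (mul_le_mul_of_nonneg_right (pow_le_pow_right₀ one_le_two (Nat.sub_le _ _)) ?_)
  have := hp.pow_nonneg (ovlp N σ τ)
  positivity

lemma ovlpBound_sq_le (N : ℕ) (σ τ : Config N) :
    ovlpBound N σ τ ^ 2 ≤ 2 * (ovlp N σ τ ^ 2 + ((N : ℝ) ^ 2)⁻¹) := by
  rw [ovlpBound, ← sq_abs (ovlp N σ τ), ← inv_pow]
  nlinarith [sq_nonneg (|ovlp N σ τ| - (N : ℝ)⁻¹)]

lemma abs_sum_fieldCoeff_mul_le {N : ℕ} (hN : 1 ≤ N) {β : ℝ} (hβ : β ∈ Set.Ioc (0 : ℝ) 1)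
    (σ σ' : Config N) :
    |∑ p, fieldCoeff N β σ p * fieldCoeff N β σ' p| ≤ ovlpBound N σ σ' := by
  rw [sum_fieldCoeff_mul hN, abs_mul, abs_mul, abs_mul, abs_spinLast hN, abs_spinLast hN, one_mul,
    one_mul, abs_of_nonneg (sq_nonneg β)]
  have h1 : β ^ 2 ≤ 1 := pow_le_one₀ hβ.1.le hβ.2
  calc _ ≤ 1 * |ovlpm N σ σ'| := mul_le_mul_of_nonneg_right h1 (abs_nonneg _)
    _ ≤ _ := by simpa using abs_ovlpm_le hN σ σ'

lemma sum_fieldCoeff_mul_self (N : ℕ) (β : ℝ) (σ σ' : Config N) :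
    ∑ p, fieldCoeff N β σ p * fieldCoeff N β σ p =
      ∑ p, fieldCoeff N β σ' p * fieldCoeff N β σ' p := by
  refine Finset.sum_congr rfl fun p _ => ?_
  unfold fieldCoeff
  split_ifs
  · linear_combination (β / √N) ^ 2 * (spin (σ p.2) ^ 2 * spin_mul_self (σ p.1) +
      spin_mul_self (σ p.2) - spin (σ' p.2) ^ 2 * spin_mul_self (σ' p.1) -
      spin_mul_self (σ' p.2))
  · rfl

/-- The sum of `ovlpBound` over ordered pairs of distinct configurations among `n` pairs. -/
def ovlpSum (N : ℕ) {n : ℕ} (ρ : Fin n → Config N × Config N) : ℝ :=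
  ∑ e ∈ (Finset.univ : Finset (Fin n × Bool)).offDiag,
    ovlpBound N (pairComponent ρ e.1) (pairComponent ρ e.2)

lemma ovlpBound_le_ovlpSum {N n : ℕ} (ρ : Fin n → Config N × Config N) {a b : Fin n × Bool}
    (hab : a ≠ b) : ovlpBound N (pairComponent ρ a) (pairComponent ρ b) ≤ ovlpSum N ρ := by
  have hmem : (a, b) ∈ (Finset.univ : Finset (Fin n × Bool)).offDiag := by simpa using hab
  have h := Finset.single_le_sum (f := fun e : (Fin n × Bool) × (Fin n × Bool) =>
    ovlpBound N (pairComponent ρ e.1) (pairComponent ρ e.2))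
    (fun _ _ => ovlpBound_nonneg _ _ _) hmem
  exact h

lemma ovlpSum_nonneg {N n : ℕ} (ρ : Fin n → Config N × Config N) : 0 ≤ ovlpSum N ρ :=
  Finset.sum_nonneg fun _ _ => ovlpBound_nonneg _ _ _

lemma abs_add_add_mul_le {a b c d t M : ℝ} (ht : t ∈ Set.Icc (0 : ℝ) 1) (ha : |a| ≤ M)
    (hb : |b| ≤ M) (hc : |c| ≤ M) (hd : |d| ≤ M) : |a + b + t * (c + d)| ≤ 4 * M := by
  have h1 : |t * (c + d)| ≤ 2 * M := by
    rw [abs_mul, abs_of_nonneg ht.1]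
    have h2 : |c + d| ≤ 2 * M := (abs_add_le _ _).trans (by linarith)
    exact (mul_le_of_le_one_left (abs_nonneg _) ht.2).trans h2
  refine (abs_add_le _ _).trans ?_
  linarith [abs_add_le a b]

lemma abs_sum_coupledCoeff_mul_le {N : ℕ} (hN : 1 ≤ N) {β t : ℝ} (hβ : β ∈ Set.Ioc (0 : ℝ) 1)
    (ht : t ∈ Set.Icc (0 : ℝ) 1) (ρ ρ' : Config N × Config N) :
    |∑ k, coupledCoeff (fieldCoeff N β) t ρ k * coupledCoeff (fieldCoeff N β) t ρ' k| ≤ 8 := by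
  have hD : ∀ σ σ', |∑ p, fieldCoeff N β σ p * fieldCoeff N β σ' p| ≤ 2 := fun σ σ' =>
    (abs_sum_fieldCoeff_mul_le hN hβ σ σ').trans (ovlpBound_le_two hN σ σ')
  rw [sum_coupledCoeff_mul _ ht]
  exact (abs_add_add_mul_le ht (hD _ _) (hD _ _) (hD _ _) (hD _ _)).trans (by norm_num)

lemma abs_replicaLap_coupledCoeff_le {N : ℕ} (hN : 1 ≤ N) {β t : ℝ}
    (hβ : β ∈ Set.Ioc (0 : ℝ) 1) (ht : t ∈ Set.Icc (0 : ℝ) 1) {n : ℕ}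
    (f : (Fin n → Config N × Config N) → ℝ) (ρ : Fin (n + 2) → Config N × Config N) :
    |replicaLap (coupledCoeff (fieldCoeff N β) t) f ρ| ≤
      |f (Fin.tail (Fin.tail ρ))| * ((n + 2) ^ 4 * (4 * ovlpSum N ρ)) := by
  have hD : ∀ a b : Fin (n + 2) × Bool, a ≠ b →
      |∑ p, fieldCoeff N β (pairComponent ρ a) p * fieldCoeff N β (pairComponent ρ b) p| ≤
        ovlpSum N ρ := fun a b hab =>
    (abs_sum_fieldCoeff_mul_le hN hβ _ _).trans (ovlpBound_le_ovlpSum ρ hab)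
  refine abs_replicaLap_le (c₀ := 2 * ∑ p, fieldCoeff N β (fun _ => true) p *
    fieldCoeff N β (fun _ => true) p) _ f ρ (fun l m hlm => ?_) fun l => ?_
  · rw [sum_coupledCoeff_mul _ ht]
    exact abs_add_add_mul_le ht (hD (l, true) (m, true) (by simp [hlm]))
      (hD (l, false) (m, false) (by simp [hlm])) (hD (l, true) (m, false) (by simp))
      (hD (l, false) (m, true) (by simp))
  · rw [sum_coupledCoeff_mul _ ht, sum_fieldCoeff_mul_self N β (ρ l).1 fun _ => true,
      sum_fieldCoeff_mul_self N β (ρ l).2 fun _ => true]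
    have h := abs_add_add_mul_le (a := 0) (b := 0) ht (by simpa using ovlpSum_nonneg ρ)
      (by simpa using ovlpSum_nonneg ρ) (hD (l, true) (l, false) (by simp))
      (hD (l, false) (l, true) (by simp))
    refine le_of_eq_of_le (congrArg abs ?_) h
    simp only [pairComponent, if_true, Bool.false_eq_true, if_false]
    ring

/-- Iterating the generator twice on a function of two pairs produces two overlap factors. -/
lemma abs_replicaLap_replicaLap_le {N : ℕ} (hN : 1 ≤ N) {β t : ℝ}
    (hβ : β ∈ Set.Ioc (0 : ℝ) 1) (ht : t ∈ Set.Icc (0 : ℝ) 1)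
    {f : (Fin 2 → Config N × Config N) → ℝ}
    {F : Config N × Config N → Config N × Config N → ℝ} (hf : ∀ ρ, |f ρ| ≤ F (ρ 0) (ρ 1))
    (ρ : Fin 6 → Config N × Config N) :
    |replicaLap (coupledCoeff (fieldCoeff N β) t)
        (replicaLap (coupledCoeff (fieldCoeff N β) t) f) ρ| ≤
      (4 ^ 5 * 6 ^ 4 * 4) * ∑ e ∈ (Finset.univ : Finset (Fin 4 × Bool)).offDiag,
        ∑ e' ∈ (Finset.univ : Finset (Fin 6 × Bool)).offDiag, F (ρ 4) (ρ 5) *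
          ovlpBound N (pairComponent ρ (e.1.1.succ.succ, e.1.2))
            (pairComponent ρ (e.2.1.succ.succ, e.2.2)) *
          ovlpBound N (pairComponent ρ e'.1) (pairComponent ρ e'.2) := by
  have h1 := abs_replicaLap_coupledCoeff_le hN hβ ht
    (replicaLap (coupledCoeff (fieldCoeff N β) t) f) ρ
  have h2 := abs_replicaLap_coupledCoeff_le hN hβ ht f (Fin.tail (Fin.tail ρ))
  have h3 : |f (Fin.tail (Fin.tail (Fin.tail (Fin.tail ρ))))| ≤ F (ρ 4) (ρ 5) := hf _
  have hS := ovlpSum_nonneg ρ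
  have hS' := ovlpSum_nonneg (Fin.tail (Fin.tail ρ))
  have h4 : ovlpSum N (Fin.tail (Fin.tail ρ)) =
      ∑ e ∈ (Finset.univ : Finset (Fin 4 × Bool)).offDiag,
        ovlpBound N (pairComponent ρ (e.1.1.succ.succ, e.1.2))
            (pairComponent ρ (e.2.1.succ.succ, e.2.2)) := rfl
  calc _ ≤ _ := h1
    _ ≤ (F (ρ 4) (ρ 5) * (((2 : ℕ) + 2) ^ 4 * (4 * ovlpSum N (Fin.tail (Fin.tail ρ))))) *
        ((((2 + 2 : ℕ) : ℝ) + 2) ^ 4 * (4 * ovlpSum N ρ)) := by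
      refine mul_le_mul_of_nonneg_right (h2.trans ?_) (by positivity)
      exact mul_le_mul_of_nonneg_right h3 (by positivity)
    _ = (4 ^ 5 * 6 ^ 4 * 4) * (F (ρ 4) (ρ 5) *
        (ovlpSum N (Fin.tail (Fin.tail ρ)) * ovlpSum N ρ)) := by
      push_cast
      ring
    _ = _ := by
      rw [h4, ovlpSum, Finset.sum_mul_sum, Finset.mul_sum]
      simp only [Finset.mul_sum, mul_assoc]

lemma iteratedDeriv_two_eq_zero_of_eq_left {F : ℝ → ℝ} {x c : ℝ} (hF : ∀ y < x, F y = c) :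
    iteratedDeriv 2 F x = 0 := by
  have aux : ∀ (G : ℝ → ℝ) (a : ℝ), (∀ y < x, G y = a) → ∀ y ≤ x, deriv G y = 0 := by
    intro G a hG y hy
    by_cases hd : DifferentiableAt ℝ G y
    · have h1 : G y = a := by
        have hc : Tendsto G (nhdsWithin y (Set.Iio y)) (nhds (G y)) :=
          hd.continuousAt.tendsto.mono_left nhdsWithin_le_nhds
        refine tendsto_nhds_unique hc (tendsto_const_nhds.congr' ?_)
        filter_upwards [self_mem_nhdsWithin] with z hz
        exact (hG z (lt_of_lt_of_le hz hy)).symm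
      have h2 : HasDerivWithinAt G 0 (Set.Iic y) y := by
        refine (hasDerivWithinAt_const y (Set.Iic y) a).congr (fun z hz => ?_) h1
        rcases (Set.mem_Iic.1 hz).lt_or_eq with h | h
        · exact hG z (h.trans_le hy)
        · rw [h, h1]
      exact (uniqueDiffWithinAt_Iic y).eq_deriv _ hd.hasDerivAt.hasDerivWithinAt h2
    · exact deriv_zero_of_not_differentiableAt hd
  rw [iteratedDeriv_succ, iteratedDeriv_one]
  exact aux _ 0 (fun y hy => aux F c hF y hy.le) x le_rfl

lemma skAvg_of_nonpos (N : ℕ) (β t : ℝ) {s : ℝ} (hs : s ≤ 0) (n : ℕ)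
    (f : (Fin n → Config N × Config N) → ℝ) : skAvg N β t s n f = skAvg N β t 0 n f := by
  have h : ∀ x, linEnergy (coupledCoeff (cavCoeff N β) t) (coupledCoeff (fieldCoeff N β) t) s x =
      linEnergy (coupledCoeff (cavCoeff N β) t) (coupledCoeff (fieldCoeff N β) t) 0 x := fun x => by
    ext ρ
    simp only [linEnergy, Real.sqrt_eq_zero_of_nonpos hs, Real.sqrt_zero]
  simp only [skAvg, gaussAvg_apply, h]

/-- The second `s`-derivative is controlled by averages at `s = 1`. -/
lemma abs_iteratedDeriv_skAvg_le {N : ℕ} (hN : 1 ≤ N) {β t s : ℝ} (hβ : β ∈ Set.Ioc (0 : ℝ) 1)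
    (ht : t ∈ Set.Icc (0 : ℝ) 1) (hs : s ∈ Set.Icc (0 : ℝ) 1)
    {f : (Fin 2 → Config N × Config N) → ℝ}
    {F : Config N × Config N → Config N × Config N → ℝ} (hf : ∀ ρ, |f ρ| ≤ F (ρ 0) (ρ 1))
    (hF : ∀ ρ ρ', 0 ≤ F ρ ρ') {B : ℝ} (hB : 0 ≤ B)
    (hbound : ∀ a b a' b' : Fin 6 × Bool, a ≠ b → a' ≠ b' →
      skAvg N β t 1 6 (fun ρ => F (ρ 4) (ρ 5) *
        ovlpBound N (pairComponent ρ a) (pairComponent ρ b) *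
          ovlpBound N (pairComponent ρ a') (pairComponent ρ b')) ≤ B) :
    |iteratedDeriv 2 (fun s' => skAvg N β t s' 2 f) s| ≤
      4 ^ 5 * 6 ^ 4 * 4 * (7392 * (Real.exp (8 ^ 4 * 8) * B)) := by
  rcases hs.1.eq_or_lt with rfl | hs0
  · rw [iteratedDeriv_two_eq_zero_of_eq_left (c := skAvg N β t 0 2 f)
      fun y hy => skAvg_of_nonpos N β t hy.le 2 f, abs_zero]
    positivity
  have hcd := coupledCoeff_mul_eq_zero (cavCoeff_mul_fieldCoeff N β) t
  have hderiv : iteratedDeriv 2 (fun s' => skAvg N β t s' 2 f) s =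
      skAvg N β t s 6 (replicaLap (coupledCoeff (fieldCoeff N β) t)
        (replicaLap (coupledCoeff (fieldCoeff N β) t) f)) := by
    rw [iteratedDeriv_succ, iteratedDeriv_one]
    have h1 : deriv (fun s' => skAvg N β t s' 2 f) =ᶠ[nhds s] fun s' =>
        skAvg N β t s' 4 (replicaLap (coupledCoeff (fieldCoeff N β) t) f) := by
      filter_upwards [lt_mem_nhds hs0] with s' hs'
      exact (hasDerivAt_gaussAvg hcd hs' f).deriv
    rw [h1.deriv_eq]
    exact (hasDerivAt_gaussAvg hcd hs0 _).deriv
  have hterm : ∀ a b a' b' : Fin 6 × Bool, a ≠ b → a' ≠ b' →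
      skAvg N β t s 6 (fun ρ => F (ρ 4) (ρ 5) *
        ovlpBound N (pairComponent ρ a) (pairComponent ρ b) *
          ovlpBound N (pairComponent ρ a') (pairComponent ρ b')) ≤
        Real.exp (8 ^ 4 * 8) * B := by
    intro a b a' b' hab hab'
    have h := gaussAvg_le_exp_mul hcd (abs_sum_coupledCoeff_mul_le hN hβ ht) (n := 6)
      (f := fun ρ => F (ρ 4) (ρ 5) * ovlpBound N (pairComponent ρ a) (pairComponent ρ b) *
          ovlpBound N (pairComponent ρ a') (pairComponent ρ b'))
      (fun ρ => mul_nonneg (mul_nonneg (hF _ _) (ovlpBound_nonneg _ _ _))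
        (ovlpBound_nonneg _ _ _)) hs0 hs.2
    have h8 : (((6 : ℕ) : ℝ) + 2) ^ 4 * 8 = 8 ^ 4 * 8 := by norm_num
    rw [h8] at h
    exact h.trans (mul_le_mul_of_nonneg_left (hbound a b a' b' hab hab') (Real.exp_pos _).le)
  rw [hderiv]
  refine (abs_gaussAvg_le _ _ s (abs_replicaLap_replicaLap_le hN hβ ht hf)).trans ?_
  have hlin : ∀ G : (Fin 4 × Bool) × (Fin 4 × Bool) → (Fin 6 × Bool) × (Fin 6 × Bool) →
      (Fin 6 → Config N × Config N) → ℝ,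
      skAvg N β t s 6 (fun ρ => (4 ^ 5 * 6 ^ 4 * 4) *
        ∑ e ∈ (Finset.univ : Finset (Fin 4 × Bool)).offDiag,
        ∑ e' ∈ (Finset.univ : Finset (Fin 6 × Bool)).offDiag, G e e' ρ) =
      (4 ^ 5 * 6 ^ 4 * 4) * ∑ e ∈ (Finset.univ : Finset (Fin 4 × Bool)).offDiag,
        ∑ e' ∈ (Finset.univ : Finset (Fin 6 × Bool)).offDiag, skAvg N β t s 6 (G e e') := by
    intro G
    have hG : (fun ρ => (4 ^ 5 * 6 ^ 4 * 4 : ℝ) *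
        ∑ e ∈ (Finset.univ : Finset (Fin 4 × Bool)).offDiag,
        ∑ e' ∈ (Finset.univ : Finset (Fin 6 × Bool)).offDiag, G e e' ρ) =
        (4 ^ 5 * 6 ^ 4 * 4 : ℝ) • ∑ e ∈ (Finset.univ : Finset (Fin 4 × Bool)).offDiag,
        ∑ e' ∈ (Finset.univ : Finset (Fin 6 × Bool)).offDiag, G e e' := by
      ext ρ
      simp only [Pi.smul_apply, Finset.sum_apply, smul_eq_mul]
    rw [hG, map_smul, smul_eq_mul, map_sum]
    simp only [map_sum]
  refine le_of_eq_of_le (hlin _) (mul_le_mul_of_nonneg_left ?_ (by norm_num))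
  calc _ ≤ ∑ _e ∈ (Finset.univ : Finset (Fin 4 × Bool)).offDiag,
        ∑ _e' ∈ (Finset.univ : Finset (Fin 6 × Bool)).offDiag, Real.exp (8 ^ 4 * 8) * B := by
        refine Finset.sum_le_sum fun e he => Finset.sum_le_sum fun e' he' =>
          hterm _ _ _ _ ?_ (Finset.mem_offDiag.1 he').2.2
        intro h
        refine (Finset.mem_offDiag.1 he).2.2 (Prod.ext ?_ (Prod.ext_iff.1 h).2)
        exact Fin.succ_injective _ (Fin.succ_injective _ (Prod.ext_iff.1 h).1)
    _ = _ := by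
        simp only [Finset.sum_const, Finset.offDiag_card, Finset.card_univ, Fintype.card_prod,
          Fintype.card_fin, Fintype.card_bool, nsmul_eq_mul]
        push_cast
        ring

lemma skAvg_mono {N : ℕ} (β t s : ℝ) {n : ℕ} {f g : (Fin n → Config N × Config N) → ℝ}
    (h : ∀ ρ, f ρ ≤ g ρ) : skAvg N β t s n f ≤ skAvg N β t s n g :=
  gaussAvg_mono _ _ s h

lemma skAvg_const_mul_add {N : ℕ} (β t s : ℝ) {n : ℕ} (c a : ℝ)
    (f : (Fin n → Config N × Config N) → ℝ) :
    skAvg N β t s n (fun ρ => c * (f ρ + a)) = c * (skAvg N β t s n f + a) := by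
  have h : (fun ρ => c * (f ρ + a)) = c • (f + fun _ => a) := rfl
  rw [h, map_smul, map_add, smul_eq_mul, skAvg, gaussAvg_const]

lemma skAvg_ovlpBound_pow_le {N : ℕ} (hN : 1 ≤ N) (β : ℝ) {t : ℝ} (ht : t ∈ Set.Icc (0 : ℝ) 1)
    {n : ℕ} {a b : Fin n × Bool} (hab : a ≠ b) {p : ℕ} (hp : Even p) :
    skAvg N β t 1 n (fun ρ => ovlpBound N (pairComponent ρ a) (pairComponent ρ b) ^ p) ≤
      2 ^ (p + 1) * Egibbs2 N β fun σ τ => ovlp N σ τ ^ p := by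
  refine (skAvg_mono β t 1 fun ρ => ovlpBound_pow_le hp _ _).trans ?_
  rw [skAvg_const_mul_add, pow_succ, mul_assoc]
  refine mul_le_mul_of_nonneg_left ?_ (by positivity)
  linarith [skAvg_ovlp_pow_le hN β ht hab p, inv_pow_le_Egibbs2 hN β hp]

lemma skAvg_ovlpBound_sq_le {N : ℕ} (hN : 1 ≤ N) (β t : ℝ) {n : ℕ} (l : Fin n) :
    skAvg N β t 1 n (fun ρ => ovlpBound N (ρ l).1 (ρ l).2 ^ 2) ≤
      4 * EgibbsTS1 N β t 1 fun ρ => ovlp N ρ.1 ρ.2 ^ 2 := by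
  refine (skAvg_mono β t 1 fun ρ => ovlpBound_sq_le N _ _).trans ?_
  rw [skAvg_const_mul_add, ← EgibbsTS1_eq_skAvg hN β t 1 (fun ρ => ovlp N ρ.1 ρ.2 ^ 2) l]
  linarith [inv_sq_le_EgibbsTS1 hN β t]

lemma skAvg_apply_mul_apply {N : ℕ} (hN : 1 ≤ N) (β t s : ℝ) (u v : Config N × Config N → ℝ)
    {n : ℕ} {l m : Fin n} (hlm : l ≠ m) :
    skAvg N β t s n (fun ρ => u (ρ l) * v (ρ m)) = EgibbsTS2 N β t s fun ρ ρ' => u ρ * v ρ' := by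
  rw [EgibbsTS2_eq_skAvg hN, skAvg_eq_integral hN, skAvg_eq_integral hN]
  simp only [replicaAvg_apply_mul_apply _ u v hlm,
    replicaAvg_apply_mul_apply _ u v (zero_ne_one : (0 : Fin 2) ≠ 1)]

lemma skAvg_ovlpBound_sq_mul_sq_le {N : ℕ} (hN : 1 ≤ N) (β t : ℝ) {n : ℕ} {l m : Fin n}
    (hlm : l ≠ m) :
    skAvg N β t 1 n (fun ρ => ovlpBound N (ρ l).1 (ρ l).2 ^ 2 * ovlpBound N (ρ m).1 (ρ m).2 ^ 2) ≤
      16 * EgibbsTS2 N β t 1 fun ρ ρ' => ovlp N ρ.1 ρ.2 ^ 2 * ovlp N ρ'.1 ρ'.2 ^ 2 := by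
  set u : Config N × Config N → ℝ := fun ρ => ovlp N ρ.1 ρ.2 ^ 2 with hu
  set e : ℝ := ((N : ℝ) ^ 2)⁻¹ with he
  have he0 : 0 ≤ e := by positivity
  have hu0 : ∀ ρ, 0 ≤ u ρ := fun ρ => sq_nonneg _
  have hsplit : (fun ρ : Fin n → Config N × Config N => 2 * (u (ρ l) + e) * (2 * (u (ρ m) + e))) =
      (4 : ℝ) • ((fun ρ => u (ρ l) * u (ρ m)) + e • (fun ρ => u (ρ l)) + e • (fun ρ => u (ρ m)) +
        fun _ => e * e) := by
    ext ρ
    simp only [Pi.smul_apply, Pi.add_apply, smul_eq_mul]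
    ring
  have hle : skAvg N β t 1 n (fun ρ => ovlpBound N (ρ l).1 (ρ l).2 ^ 2 *
      ovlpBound N (ρ m).1 (ρ m).2 ^ 2) ≤
      skAvg N β t 1 n fun ρ => 2 * (u (ρ l) + e) * (2 * (u (ρ m) + e)) :=
    skAvg_mono β t 1 fun ρ => mul_le_mul (ovlpBound_sq_le N _ _) (ovlpBound_sq_le N _ _)
      (sq_nonneg _) (by have := hu0 (ρ l); positivity)
  have hconst : skAvg N β t 1 n (fun _ => e * e) = e * e := gaussAvg_const _ _ _ _ _
  rw [hsplit, map_smul, map_add, map_add, map_add, map_smul, map_smul, hconst,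
    skAvg_apply_mul_apply hN β t 1 u u hlm, ← EgibbsTS1_eq_skAvg hN, ← EgibbsTS1_eq_skAvg hN,
    smul_eq_mul, smul_eq_mul] at hle
  have h1 : e ≤ EgibbsTS1 N β t 1 u := inv_sq_le_EgibbsTS1 hN β t
  have h2 := sq_EgibbsTS1_le hN β t 1 u
  refine hle.trans ?_
  nlinarith

lemma skAvg_prod_rpow_le {N : ℕ} (β t s : ℝ) {n : ℕ} {ι : Type*} [Fintype ι]
    {h : ι → (Fin n → Config N × Config N) → ℝ} {w B : ι → ℝ} {C : ℝ} (hC : 0 < C)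
    (hh : ∀ i ρ, 0 ≤ h i ρ) (hw : ∀ i, 0 ≤ w i) (hw1 : ∑ i, w i = 1) (hB : ∀ i, 0 < B i)
    (hle : ∀ i, skAvg N β t s n (h i) ≤ C * B i) :
    skAvg N β t s n (fun ρ => ∏ i, h i ρ ^ w i) ≤ C * ∏ i, B i ^ w i := by
  refine (gaussAvg_prod_rpow_le hh hw hw1 (fun i => mul_pos hC (hB i)) hle).trans_eq ?_
  simp only [fun i => Real.mul_rpow (z := w i) hC.le (hB i).le, Finset.prod_mul_distrib]
  rw [← Real.rpow_sum_of_pos hC, hw1, Real.rpow_one]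

lemma pow_rpow_eq {x : ℝ} (hx : 0 ≤ x) (p : ℕ) (w : ℝ) : (x ^ p) ^ w = x ^ ((p : ℝ) * w) := by
  rw [← Real.rpow_natCast, ← Real.rpow_mul hx]

lemma Egibbs2_ovlp_pow_pos {N : ℕ} (hN : 1 ≤ N) (β : ℝ) {p : ℕ} (hp : Even p) :
    0 < Egibbs2 N β fun σ τ => ovlp N σ τ ^ p := by
  have hN' : (0 : ℝ) < N := by exact_mod_cast hN
  exact lt_of_lt_of_le (by positivity) (inv_pow_le_Egibbs2 hN β hp)

lemma EgibbsTS1_ovlp_sq_pos {N : ℕ} (hN : 1 ≤ N) (β t : ℝ) :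
    0 < EgibbsTS1 N β t 1 fun ρ => ovlp N ρ.1 ρ.2 ^ 2 := by
  have hN' : (0 : ℝ) < N := by exact_mod_cast hN
  exact lt_of_lt_of_le (by positivity) (inv_sq_le_EgibbsTS1 hN β t)

lemma EgibbsTS2_ovlp_sq_pos {N : ℕ} (hN : 1 ≤ N) (β t : ℝ) :
    0 < EgibbsTS2 N β t 1 fun ρ ρ' => ovlp N ρ.1 ρ.2 ^ 2 * ovlp N ρ'.1 ρ'.2 ^ 2 :=
  lt_of_lt_of_le (pow_pos (EgibbsTS1_ovlp_sq_pos hN β t) 2)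
    (sq_EgibbsTS1_le hN β t 1 fun ρ => ovlp N ρ.1 ρ.2 ^ 2)

lemma skAvg_le_sq_mul_sixteenth {N : ℕ} (hN : 1 ≤ N) (β : ℝ) {t : ℝ} (ht : t ∈ Set.Icc (0 : ℝ) 1)
    {a b a' b' : Fin 6 × Bool} (hab : a ≠ b) (hab' : a' ≠ b') :
    skAvg N β t 1 6 (fun ρ => ovlpBound N (ρ 4).1 (ρ 4).2 * ovlpBound N (ρ 5).1 (ρ 5).2 ^ 2 *
        ovlpBound N (pairComponent ρ a) (pairComponent ρ b) *
          ovlpBound N (pairComponent ρ a') (pairComponent ρ b')) ≤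
      2 ^ 17 * ((EgibbsTS1 N β t 1 fun ρ => ovlp N ρ.1 ρ.2 ^ 2) ^ ((3 : ℝ) / 4) *
        (Egibbs2 N β fun σ τ => ovlp N σ τ ^ 16) ^ ((7 : ℝ) / 32)) := by
  set A := EgibbsTS1 N β t 1 fun ρ => ovlp N ρ.1 ρ.2 ^ 2 with hA
  set D := Egibbs2 N β fun σ τ => ovlp N σ τ ^ 16 with hD
  have hA0 : 0 < A := EgibbsTS1_ovlp_sq_pos hN β t
  have hD0 : 0 < D := Egibbs2_ovlp_pow_pos hN β (by decide)
  have hsq : ∀ l : Fin 6, skAvg N β t 1 6 (fun ρ => ovlpBound N (ρ l).1 (ρ l).2 ^ 2) ≤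
      2 ^ 17 * A := fun l => (skAvg_ovlpBound_sq_le hN β t l).trans (by rw [← hA]; linarith)
  have hmom : ∀ c d : Fin 6 × Bool, c ≠ d → skAvg N β t 1 6 (fun ρ =>
      ovlpBound N (pairComponent ρ c) (pairComponent ρ d) ^ 16) ≤ 2 ^ 17 * D :=
    fun c d hcd => skAvg_ovlpBound_pow_le hN β ht hcd (by decide)
  have hone : skAvg N β t 1 6 (fun _ => 1) = 1 := gaussAvg_const _ _ _ _ _
  have hq := ovlpBound_nonneg N
  have key := skAvg_prod_rpow_le (N := N) β t 1 (n := 6) (C := 2 ^ 17)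
    (h := ![fun ρ => ovlpBound N (ρ 4).1 (ρ 4).2 ^ 2, fun ρ => ovlpBound N (ρ 5).1 (ρ 5).2 ^ 2,
      fun ρ => ovlpBound N (ρ 4).1 (ρ 4).2 ^ 16, fun ρ => ovlpBound N (ρ 5).1 (ρ 5).2 ^ 16,
      fun ρ => ovlpBound N (pairComponent ρ a) (pairComponent ρ b) ^ 16,
      fun ρ => ovlpBound N (pairComponent ρ a') (pairComponent ρ b') ^ 16, fun _ => 1])
    (w := ![1 / 4, 1 / 2, 1 / 32, 1 / 16, 1 / 16, 1 / 16, 1 / 32]) (B := ![A, A, D, D, D, D, 1])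
    (by norm_num)
    (by
      intro i ρ
      fin_cases i <;> first | exact pow_nonneg (hq _ _) _ | exact zero_le_one)
    (by intro i; fin_cases i <;> norm_num)
    (by simp [Fin.sum_univ_succ]; norm_num)
    (by intro i; fin_cases i <;> first | exact hA0 | exact hD0 | exact one_pos)
    (by
      intro i
      fin_cases i
      · exact hsq 4
      · exact hsq 5
      · exact hmom (4, true) (4, false) (by decide)
      · exact hmom (5, true) (5, false) (by decide)
      · exact hmom a b hab
      · exact hmom a' b' hab'
      · exact hone.trans_le (by norm_num : (1 : ℝ) ≤ 2 ^ 17 * 1))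
  simp only [Fin.prod_univ_succ, Fin.prod_univ_zero, Matrix.cons_val_zero, Matrix.cons_val_succ,
    Real.one_rpow, mul_one] at key
  refine le_trans (le_of_eq ?_) (key.trans (le_of_eq ?_))
  · congr 1
    ext ρ
    simp only [pow_rpow_eq (hq _ _)]
    have h1 : ∀ x : ℝ, 0 ≤ x → x ^ (((2 : ℕ) : ℝ) * (1 / 4)) * x ^ (((16 : ℕ) : ℝ) * (1 / 32)) = x :=
      fun x hx => by rw [← Real.rpow_add_of_nonneg hx (by norm_num) (by norm_num)]; norm_num
    have h2 : ∀ x : ℝ, x ^ (((16 : ℕ) : ℝ) * (1 / 16)) = x := fun x => by norm_num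
    have h3 : ∀ x : ℝ, x ^ (((2 : ℕ) : ℝ) * (1 / 2)) = x := fun x => by norm_num
    rw [h2, h2, h2, h3]
    linear_combination (-(ovlpBound N (ρ 5).1 (ρ 5).2 ^ 2 *
        ovlpBound N (pairComponent ρ a) (pairComponent ρ b) *
          ovlpBound N (pairComponent ρ a') (pairComponent ρ b'))) * h1 _ (hq (ρ 4).1 (ρ 4).2)
  · have h1 : A ^ ((3 : ℝ) / 4) = A ^ ((1 : ℝ) / 4) * A ^ ((1 : ℝ) / 2) := by
      rw [← Real.rpow_add hA0]; norm_num
    have h2 : D ^ ((7 : ℝ) / 32) = D ^ ((1 : ℝ) / 32) * (D ^ ((1 : ℝ) / 16) *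
        (D ^ ((1 : ℝ) / 16) * D ^ ((1 : ℝ) / 16))) := by
      rw [← Real.rpow_add hD0, ← Real.rpow_add hD0, ← Real.rpow_add hD0]; norm_num
    rw [h1, h2]
    ring

lemma skAvg_le_sq_mul_sq_mul_eighth {N : ℕ} (hN : 1 ≤ N) (β : ℝ) {t : ℝ} (ht : t ∈ Set.Icc (0 : ℝ) 1)
    {a b a' b' : Fin 6 × Bool} (hab : a ≠ b) (hab' : a' ≠ b') :
    skAvg N β t 1 6 (fun ρ => ovlpBound N (ρ 4).1 (ρ 4).2 * ovlpBound N (ρ 5).1 (ρ 5).2 ^ 2 *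
        ovlpBound N (pairComponent ρ a) (pairComponent ρ b) *
          ovlpBound N (pairComponent ρ a') (pairComponent ρ b')) ≤
      2 ^ 17 * ((EgibbsTS2 N β t 1 fun ρ ρ' => ovlp N ρ.1 ρ.2 ^ 2 * ovlp N ρ'.1 ρ'.2 ^ 2) ^
          ((1 : ℝ) / 2) *
        (EgibbsTS1 N β t 1 fun ρ => ovlp N ρ.1 ρ.2 ^ 2) ^ ((1 : ℝ) / 6) *
          (Egibbs2 N β fun σ τ => ovlp N σ τ ^ 8) ^ ((1 : ℝ) / 3)) := by
  set A := EgibbsTS1 N β t 1 fun ρ => ovlp N ρ.1 ρ.2 ^ 2 with hA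
  set A' := EgibbsTS2 N β t 1 fun ρ ρ' => ovlp N ρ.1 ρ.2 ^ 2 * ovlp N ρ'.1 ρ'.2 ^ 2 with hA'
  set D := Egibbs2 N β fun σ τ => ovlp N σ τ ^ 8 with hD
  have hA0 : 0 < A := EgibbsTS1_ovlp_sq_pos hN β t
  have hA0' : 0 < A' := EgibbsTS2_ovlp_sq_pos hN β t
  have hD0 : 0 < D := Egibbs2_ovlp_pow_pos hN β (by decide)
  have hmom : ∀ c d : Fin 6 × Bool, c ≠ d → skAvg N β t 1 6 (fun ρ =>
      ovlpBound N (pairComponent ρ c) (pairComponent ρ d) ^ 8) ≤ 2 ^ 17 * D :=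
    fun c d hcd => (skAvg_ovlpBound_pow_le hN β ht hcd (by decide)).trans
      (mul_le_mul_of_nonneg_right (by norm_num) hD0.le)
  have hq := ovlpBound_nonneg N
  have key := skAvg_prod_rpow_le (N := N) β t 1 (n := 6) (C := 2 ^ 17)
    (h := ![fun ρ => ovlpBound N (ρ 4).1 (ρ 4).2 ^ 2 * ovlpBound N (ρ 5).1 (ρ 5).2 ^ 2,
      fun ρ => ovlpBound N (ρ 5).1 (ρ 5).2 ^ 2, fun ρ => ovlpBound N (ρ 5).1 (ρ 5).2 ^ 8,
      fun ρ => ovlpBound N (pairComponent ρ a) (pairComponent ρ b) ^ 8,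
      fun ρ => ovlpBound N (pairComponent ρ a') (pairComponent ρ b') ^ 8])
    (w := ![1 / 2, 1 / 6, 1 / 12, 1 / 8, 1 / 8]) (B := ![A', A, D, D, D])
    (by norm_num)
    (by
      intro i ρ
      fin_cases i <;> first
        | exact pow_nonneg (hq _ _) _
        | exact mul_nonneg (pow_nonneg (hq _ _) _) (pow_nonneg (hq _ _) _))
    (by intro i; fin_cases i <;> norm_num)
    (by simp [Fin.sum_univ_succ]; norm_num)
    (by intro i; fin_cases i <;> first | exact hA0 | exact hD0 | exact hA0')
    (by
      intro i
      fin_cases i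
      · exact (skAvg_ovlpBound_sq_mul_sq_le hN β t (by decide)).trans
          (mul_le_mul_of_nonneg_right (by norm_num) hA0'.le)
      · exact (skAvg_ovlpBound_sq_le hN β t 5).trans
          (mul_le_mul_of_nonneg_right (by norm_num) hA0.le)
      · exact hmom (5, true) (5, false) (by decide)
      · exact hmom a b hab
      · exact hmom a' b' hab')
  simp only [Fin.prod_univ_succ, Fin.prod_univ_zero, Matrix.cons_val_zero, Matrix.cons_val_succ,
    mul_one] at key
  refine le_trans (le_of_eq ?_) (key.trans (le_of_eq ?_))
  · congr 1
    ext ρ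
    simp only [← mul_pow, pow_rpow_eq (hq _ _), pow_rpow_eq (mul_nonneg (hq _ _) (hq _ _))]
    have h1 : ∀ x : ℝ, 0 ≤ x → x ^ (((2 : ℕ) : ℝ) * (1 / 6)) * x ^ (((8 : ℕ) : ℝ) * (1 / 12)) = x :=
      fun x hx => by rw [← Real.rpow_add_of_nonneg hx (by norm_num) (by norm_num)]; norm_num
    have h2 : ∀ x : ℝ, x ^ (((8 : ℕ) : ℝ) * (1 / 8)) = x := fun x => by norm_num
    have h3 : ∀ x : ℝ, x ^ (((2 : ℕ) : ℝ) * (1 / 2)) = x := fun x => by norm_num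
    rw [h2, h2, h3]
    linear_combination (-(ovlpBound N (ρ 4).1 (ρ 4).2 * ovlpBound N (ρ 5).1 (ρ 5).2 *
        ovlpBound N (pairComponent ρ a) (pairComponent ρ b) *
          ovlpBound N (pairComponent ρ a') (pairComponent ρ b'))) * h1 _ (hq (ρ 5).1 (ρ 5).2)
  · have h2 : D ^ ((1 : ℝ) / 3) = D ^ ((1 : ℝ) / 12) * (D ^ ((1 : ℝ) / 8) *
        D ^ ((1 : ℝ) / 8)) := by
      rw [← Real.rpow_add hD0, ← Real.rpow_add hD0]; norm_num
    rw [h2]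
    ring

/-- second `s`-derivative bounds for
`f₂(ρ¹,ρ²) = σ_N¹ τ_N¹ R⁻(σ¹,τ¹) R(σ²,τ²)²`. -/
theorem sk_second_derivative_bounds :
    ∃ K : ℝ, 0 < K ∧ ∀ N : ℕ, 1 ≤ N → ∀ β ∈ Set.Ioc (0 : ℝ) 1,
      ∀ t ∈ Set.Icc (0 : ℝ) 1, ∀ s ∈ Set.Icc (0 : ℝ) 1,
      |iteratedDeriv 2 (fun s' => EgibbsTS2 N β t s' (fun ρ₁ ρ₂ =>
          spinLast ρ₁.1 * spinLast ρ₁.2 * ovlpm N ρ₁.1 ρ₁.2 * ovlp N ρ₂.1 ρ₂.2 ^ 2)) s| ≤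
        K * (EgibbsTS1 N β t 1 (fun ρ => ovlp N ρ.1 ρ.2 ^ 2)) ^ ((3 : ℝ) / 4) *
          (Egibbs2 N β (fun σ τ => ovlp N σ τ ^ 16)) ^ ((7 : ℝ) / 32) ∧
      |iteratedDeriv 2 (fun s' => EgibbsTS2 N β t s' (fun ρ₁ ρ₂ =>
          spinLast ρ₁.1 * spinLast ρ₁.2 * ovlpm N ρ₁.1 ρ₁.2 * ovlp N ρ₂.1 ρ₂.2 ^ 2)) s| ≤
        K * (EgibbsTS2 N β t 1
            (fun ρ₁ ρ₂ => ovlp N ρ₁.1 ρ₁.2 ^ 2 * ovlp N ρ₂.1 ρ₂.2 ^ 2)) ^ ((1 : ℝ) / 2) *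
          (EgibbsTS1 N β t 1 (fun ρ => ovlp N ρ.1 ρ.2 ^ 2)) ^ ((1 : ℝ) / 6) *
          (Egibbs2 N β (fun σ τ => ovlp N σ τ ^ 8)) ^ ((1 : ℝ) / 3) := by
  refine ⟨4 ^ 5 * 6 ^ 4 * 4 * (7392 * (Real.exp (8 ^ 4 * 8) * 2 ^ 17)), by positivity,
    fun N hN β hβ t ht s hs => ?_⟩
  have hf : ∀ ρ : Fin 2 → Config N × Config N, |spinLast (ρ 0).1 * spinLast (ρ 0).2 *
      ovlpm N (ρ 0).1 (ρ 0).2 * ovlp N (ρ 1).1 (ρ 1).2 ^ 2| ≤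
        ovlpBound N (ρ 0).1 (ρ 0).2 * ovlpBound N (ρ 1).1 (ρ 1).2 ^ 2 := by
    intro ρ
    rw [abs_mul, abs_mul, abs_mul, abs_spinLast hN, abs_spinLast hN, abs_pow, one_mul, one_mul]
    have h1 := abs_ovlpm_le hN (ρ 0).1 (ρ 0).2
    have h2 := abs_ovlp_le_ovlpBound N (ρ 1).1 (ρ 1).2
    have h3 := ovlpBound_nonneg N (ρ 0).1 (ρ 0).2
    gcongr
  have hF : ∀ ρ ρ' : Config N × Config N,
      0 ≤ ovlpBound N ρ.1 ρ.2 * ovlpBound N ρ'.1 ρ'.2 ^ 2 := fun ρ ρ' =>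
    mul_nonneg (ovlpBound_nonneg _ _ _) (sq_nonneg _)
  have hA0 := EgibbsTS1_ovlp_sq_pos hN β t
  have hA0' := EgibbsTS2_ovlp_sq_pos hN β t
  have hD8 := Egibbs2_ovlp_pow_pos hN β (p := 8) (by decide)
  have hD16 := Egibbs2_ovlp_pow_pos hN β (p := 16) (by decide)
  simp only [fun s' => EgibbsTS2_eq_skAvg hN β t s' fun ρ₁ ρ₂ =>
    spinLast ρ₁.1 * spinLast ρ₁.2 * ovlpm N ρ₁.1 ρ₁.2 * ovlp N ρ₂.1 ρ₂.2 ^ 2]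
  constructor
  · refine (abs_iteratedDeriv_skAvg_le hN hβ ht hs
      (F := fun ρ ρ' => ovlpBound N ρ.1 ρ.2 * ovlpBound N ρ'.1 ρ'.2 ^ 2) hf hF (by positivity)
      fun a b a' b' hab hab' => skAvg_le_sq_mul_sixteenth hN β ht hab hab').trans_eq ?_
    ring
  · refine (abs_iteratedDeriv_skAvg_le hN hβ ht hs
      (F := fun ρ ρ' => ovlpBound N ρ.1 ρ.2 * ovlpBound N ρ'.1 ρ'.2 ^ 2) hf hF (by positivity)
      fun a b a' b' hab hab' => skAvg_le_sq_mul_sq_mul_eighth hN β ht hab hab').trans_eq ?_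
    ring

end
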